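/- Let (X, Π, 𝓑) be a system of d-boxes and let 𝓖 ⊆ 𝓑 be a finite Keller family. Then c(𝓖) = |𝓖| − 1 if and only if 𝓖 is a multipile. -/

import Mathlib

open Set

/-- A partition of a type `α`: a family of nonempty pairwise disjoint subsets whose union
is everything. -/
def IsPartition {α : Type*} (π : Set (Set α)) : Prop :=
  (∀ A ∈ π, A.Nonempty) ∧ π.PairwiseDisjoint id ∧ ⋃₀ π = Set.univ

/-- `Coarser π ρ` means `ρ` is coarser than `π`: every part of `π` lies in a part of `ρ`. -/
def Coarser {α : Type*} (π ρ : Set (Set α)) : Prop :=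
  ∀ A ∈ π, ∃ B ∈ ρ, A ⊆ B

/-- Two partitions are independent if the only partition coarser than both is the trivial
partition `{univ}`. -/
def IndepPartitions {α : Type*} (π π' : Set (Set α)) : Prop :=
  ∀ ρ : Set (Set α), IsPartition ρ → Coarser π ρ → Coarser π' ρ → ρ = {Set.univ}

/-- A system of `d`-boxes: each `X i` has at least two elements, and `P i` is a finite
family of pairwise independent finite partitions of `X i`. -/
def IsBoxSystem {d : ℕ} (X : Fin d → Type*) (P : ∀ i, Set (Set (Set (X i)))) : Prop :=
  (∀ i, Nontrivial (X i)) ∧ (∀ i, (P i).Finite) ∧ (∀ i, ∀ π ∈ P i, π.Finite) ∧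
    (∀ i, ∀ π ∈ P i, IsPartition π) ∧
    (∀ i, ∀ π ∈ P i, ∀ π' ∈ P i, π ≠ π' → IndepPartitions π π')

/-- `K` is a box: every factor `K i` is a part of some partition in `P i`. -/
def IsBox {d : ℕ} {X : Fin d → Type*} (P : ∀ i, Set (Set (Set (X i))))
    (K : ∀ i, Set (X i)) : Prop :=
  ∀ i, ∃ π ∈ P i, K i ∈ π

/-- The subset of `X` determined by the box `K`. -/
def boxSet {d : ℕ} {X : Fin d → Type*} (K : ∀ i, Set (X i)) : Set (∀ i, X i) :=
  Set.univ.pi K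

/-- Keller's condition for a pair of boxes: in some coordinate the factors are distinct
parts of one partition. -/
def KellerPair {d : ℕ} {X : Fin d → Type*} (P : ∀ i, Set (Set (Set (X i))))
    (K L : ∀ i, Set (X i)) : Prop :=
  ∃ i, ∃ π ∈ P i, K i ∈ π ∧ L i ∈ π ∧ K i ≠ L i

/-- A Keller family: a nonempty family of boxes any two distinct members of which satisfy
Keller's condition. -/
def IsKellerFamily {d : ℕ} {X : Fin d → Type*} (P : ∀ i, Set (Set (Set (X i))))
    (G : Set (∀ i, Set (X i))) : Prop :=
  G.Nonempty ∧ (∀ K ∈ G, IsBox P K) ∧ ∀ K ∈ G, ∀ L ∈ G, K ≠ L → KellerPair P K L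

/-- The union (polybox) of a family of boxes. -/
def polyUnion {d : ℕ} {X : Fin d → Type*} (G : Set (∀ i, Set (X i))) : Set (∀ i, X i) :=
  ⋃ K ∈ G, boxSet K

/-- The restriction `𝓖|𝓥 = {K ∈ 𝓖 : K i ∈ 𝓥}`. -/
def restrictFam {d : ℕ} {X : Fin d → Type*} (G : Set (∀ i, Set (X i))) (i : Fin d)
    (V : Set (Set (X i))) : Set (∀ i, Set (X i)) :=
  {K ∈ G | K i ∈ V}

/-- An `i`-cylinder: together with any point it contains the whole line through that point
in direction `i`. -/
def IsCylinder {d : ℕ} {X : Fin d → Type*} (i : Fin d) (W : Set (∀ j, X j)) : Prop :=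
  ∀ x ∈ W, ∀ y : X i, Function.update x i y ∈ W

/-- `π` is present in `𝓖` if some box of `𝓖` has its `i`-th factor in `π`. -/
def PresentIn {d : ℕ} {X : Fin d → Type*} (G : Set (∀ i, Set (X i))) (i : Fin d)
    (π : Set (Set (X i))) : Prop :=
  ∃ K ∈ G, K i ∈ π

/-- A nontrivial partition `π ∈ P i` is hidden in `𝓖` if `𝓖|π` is a suit for an
`i`-cylinder. -/
def HiddenIn {d : ℕ} {X : Fin d → Type*} (P : ∀ i, Set (Set (Set (X i))))
    (G : Set (∀ i, Set (X i))) (i : Fin d) (π : Set (Set (X i))) : Prop :=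
  π ∈ P i ∧ π ≠ {Set.univ} ∧ IsKellerFamily P (restrictFam G i π) ∧
    IsCylinder i (polyUnion (restrictFam G i π))

/-- A nontrivial partition `π ∈ P i` is exposed in `𝓖` if it is present and not hidden. -/
def ExposedIn {d : ℕ} {X : Fin d → Type*} (P : ∀ i, Set (Set (Set (X i))))
    (G : Set (∀ i, Set (X i))) (i : Fin d) (π : Set (Set (X i))) : Prop :=
  π ∈ P i ∧ π ≠ {Set.univ} ∧ PresentIn G i π ∧ ¬ HiddenIn P G i π

/-- `C i (𝓖)`: the set of partitions in `P i` hidden in `𝓖`. -/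
def hiddenSet {d : ℕ} {X : Fin d → Type*} (P : ∀ i, Set (Set (Set (X i))))
    (G : Set (∀ i, Set (X i))) (i : Fin d) : Set (Set (Set (X i))) :=
  {π | HiddenIn P G i π}

/-- `c_i(𝓖) = Σ_{π ∈ C_i(𝓖)} (|π| - 1)`. -/
noncomputable def cIdx {d : ℕ} {X : Fin d → Type*} (P : ∀ i, Set (Set (Set (X i))))
    (G : Set (∀ i, Set (X i))) (i : Fin d) : ℕ :=
  ∑ᶠ π ∈ hiddenSet P G i, (π.ncard - 1)

/-- `c(𝓖) = Σ_i c_i(𝓖)`. -/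
noncomputable def cTotal {d : ℕ} {X : Fin d → Type*} (P : ∀ i, Set (Set (Set (X i))))
    (G : Set (∀ i, Set (X i))) : ℕ :=
  ∑ i, cIdx P G i

/-- Multipiles, defined recursively: either a single box, or an `i`-pile laminated with
respect to a nontrivial `π ∈ P i` whose restrictions `𝓖|A`, `A ∈ π`, are multipiles with
pairwise disjoint families of hidden partitions in every direction `k ≠ i`. -/
inductive IsMultipile {d : ℕ} {X : Fin d → Type*} (P : ∀ i, Set (Set (Set (X i)))) :
    Set (∀ i, Set (X i)) → Prop
  | single (K : ∀ i, Set (X i)) (hK : IsBox P K) : IsMultipile P {K}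
  | pile (G : Set (∀ i, Set (X i))) (i : Fin d) (π : Set (Set (X i)))
      (hπ : π ∈ P i) (hnt : π ≠ {Set.univ})
      (hK : IsKellerFamily P G)
      (hlam : restrictFam G i π = G)
      (hcyl : IsCylinder i (polyUnion G))
      (hsub : ∀ A ∈ π, IsMultipile P (restrictFam G i {A}))
      (hdis : ∀ k, k ≠ i → ∀ A ∈ π, ∀ B ∈ π, A ≠ B → ∀ ρ,
          ¬ (HiddenIn P (restrictFam G i {A}) k ρ ∧ HiddenIn P (restrictFam G i {B}) k ρ)) :
      IsMultipile P G

section Aux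

variable {d : ℕ} {X : Fin d → Type*} {P : ∀ i, Set (Set (Set (X i)))}

lemma sat_eq (hsys : IsBoxSystem X P) {i : Fin d} {π ρ : Set (Set (X i))} (hπ : π ∈ P i)
    (hρ : ρ ∈ P i) (hne : π ≠ ρ) {S : Set (X i)} (hS : S.Nonempty)
    (h1 : ∀ D ∈ π, ∀ b ∈ D, b ∈ S → D ⊆ S) (h2 : ∀ D ∈ ρ, ∀ b ∈ D, b ∈ S → D ⊆ S) :
    S = Set.univ := by
  by_contra hu
  have hc : Sᶜ.Nonempty := by
    rw [Set.nonempty_compl]; exact hu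
  have hpart : IsPartition ({S, Sᶜ} : Set (Set (X i))) := by
    refine ⟨?_, ?_, ?_⟩
    · rintro A (rfl | rfl)
      · exact hS
      · exact hc
    · rintro A (rfl | rfl) B (rfl | rfl) hAB
      · exact (hAB rfl).elim
      · exact disjoint_compl_right
      · exact disjoint_compl_left
      · exact (hAB rfl).elim
    · simp
  have hco : ∀ τ : Set (Set (X i)), (∀ D ∈ τ, ∀ b ∈ D, b ∈ S → D ⊆ S) →
      Coarser τ ({S, Sᶜ} : Set (Set (X i))) := by
    intro τ hτ D hD
    by_cases h : ∃ b ∈ D, b ∈ S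
    · obtain ⟨b, hb, hbS⟩ := h
      exact ⟨S, by simp, hτ D hD b hb hbS⟩
    · exact ⟨Sᶜ, by simp, fun b hb hbS => h ⟨b, hb, hbS⟩⟩
  have := hsys.2.2.2.2 i π hπ ρ hρ hne _ hpart (hco π h1) (hco ρ h2)
  have hmem : S ∈ ({Set.univ} : Set (Set (X i))) := by rw [← this]; simp
  exact hu hmem

lemma part_eq (hsys : IsBoxSystem X P) {i : Fin d} {π : Set (Set (X i))} (hπ : π ∈ P i)
    {A B : Set (X i)} (hA : A ∈ π) (hB : B ∈ π) {b : X i} (hbA : b ∈ A) (hbB : b ∈ B) :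
    A = B := by
  by_contra h
  exact Set.disjoint_left.1 ((hsys.2.2.2.1 i π hπ).2.1 hA hB h) hbA hbB

lemma part_unique (hsys : IsBoxSystem X P) {i : Fin d} {π ρ : Set (Set (X i))} (hπ : π ∈ P i)
    (hρ : ρ ∈ P i) {A : Set (X i)} (h1 : A ∈ π) (h2 : A ∈ ρ) (hA : A ≠ Set.univ) : π = ρ := by
  by_contra hne
  apply hA
  apply sat_eq hsys hπ hρ hne ((hsys.2.2.2.1 i π hπ).1 A h1)
  · intro D hD b hb hbA
    rw [part_eq hsys hπ hD h1 hb hbA]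
  · intro D hD b hb hbA
    rw [part_eq hsys hρ hD h2 hb hbA]

lemma ne_univ (hsys : IsBoxSystem X P) {i : Fin d} {π : Set (Set (X i))} (hπ : π ∈ P i)
    (hnt : π ≠ {Set.univ}) {A : Set (X i)} (h1 : A ∈ π) : A ≠ Set.univ := by
  rintro rfl
  apply hnt
  ext B
  constructor
  · intro hB
    obtain ⟨b, hb⟩ := (hsys.2.2.2.1 i π hπ).1 B hB
    exact part_eq hsys hπ hB h1 hb (Set.mem_univ b)
  · rintro rfl; exact h1

lemma exists_part (hsys : IsBoxSystem X P) {i : Fin d} {π : Set (Set (X i))} (hπ : π ∈ P i)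
    (x : X i) : ∃ A ∈ π, x ∈ A := by
  have : x ∈ ⋃₀ π := by rw [(hsys.2.2.2.1 i π hπ).2.2]; trivial
  simpa using this

lemma mem_boxSet {K : ∀ i, Set (X i)} {x : ∀ i, X i} : x ∈ boxSet K ↔ ∀ i, x i ∈ K i := by
  simp [boxSet]

lemma mem_poly {G : Set (∀ i, Set (X i))} {x : ∀ i, X i} :
    x ∈ polyUnion G ↔ ∃ K ∈ G, x ∈ boxSet K := by
  simp [polyUnion]

lemma box_unique (hsys : IsBoxSystem X P) {G : Set (∀ i, Set (X i))} (hG : IsKellerFamily P G)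
    {K L : ∀ i, Set (X i)} (hK : K ∈ G) (hL : L ∈ G) {x : ∀ i, X i} (hx : x ∈ boxSet K)
    (hx' : x ∈ boxSet L) : K = L := by
  by_contra h
  obtain ⟨i, π, hπ, h1, h2, h3⟩ := hG.2.2 K hK L hL h
  exact h3 (part_eq hsys hπ h1 h2 (mem_boxSet.1 hx i) (mem_boxSet.1 hx' i))

lemma box_nonempty (hsys : IsBoxSystem X P) {K : ∀ i, Set (X i)} (hK : IsBox P K) :
    (boxSet K).Nonempty := by
  have : ∀ i, ∃ x, x ∈ K i := by
    intro i
    obtain ⟨π, hπ, h⟩ := hK i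
    exact (hsys.2.2.2.1 i π hπ).1 _ h
  choose x hx using this
  exact ⟨x, mem_boxSet.2 hx⟩

lemma keller_sub {G H : Set (∀ i, Set (X i))} (hG : IsKellerFamily P G) (hH : H ⊆ G)
    (hne : H.Nonempty) : IsKellerFamily P H :=
  ⟨hne, fun K hK => hG.2.1 K (hH hK), fun K hK L hL => hG.2.2 K (hH hK) L (hH hL)⟩

lemma update_box {K : ∀ i, Set (X i)} {x : ∀ i, X i} {k : Fin d} {b c : X k}
    (h : Function.update x k b ∈ boxSet K) (hc : c ∈ K k) :
    Function.update x k c ∈ boxSet K := by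
  rw [mem_boxSet] at h ⊢
  intro j
  by_cases hj : j = k
  · subst hj; simpa using hc
  · have := h j
    simpa [hj] using this

lemma cyl_iff {i : Fin d} {W : Set (∀ j, X j)} (hW : IsCylinder i W) (x : ∀ j, X j) (a : X i) :
    Function.update x i a ∈ W ↔ x ∈ W := by
  constructor
  · intro h
    have := hW _ h (x i)
    simpa using this
  · intro h; exact hW x h a

lemma fiber_sat (hsys : IsBoxSystem X P) {H : Set (∀ i, Set (X i))} (hH : IsKellerFamily P H)
    {x : ∀ i, X i} {k : Fin d} {b : X k} {K : ∀ i, Set (X i)} (hK : K ∈ H)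
    (hx : Function.update x k b ∈ boxSet K) {ρ : Set (Set (X k))} (hρ : ρ ∈ P k)
    (hKρ : K k ∈ ρ) (hne : K k ≠ Set.univ) {L : ∀ i, Set (X i)} (hL : L ∈ H) {c : X k}
    (hc : Function.update x k c ∈ boxSet L) : L k ∈ ρ := by
  by_cases hKL : K = L
  · rw [← hKL]; exact hKρ
  obtain ⟨j, π, hπ, h1, h2, h3⟩ := hH.2.2 K hK L hL hKL
  by_cases hj : j = k
  · subst hj
    rw [part_unique hsys hρ hπ hKρ h1 hne]; exact h2
  · exfalso
    apply h3
    have e1 := mem_boxSet.1 hx j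
    have e2 := mem_boxSet.1 hc j
    simp only [ne_eq, hj, not_false_eq_true, Function.update_of_ne] at e1 e2
    exact part_eq hsys hπ h1 h2 e1 e2

lemma fiber_eq (hsys : IsBoxSystem X P) {H H' : Set (∀ i, Set (X i))} (hH : IsKellerFamily P H)
    (hH' : IsKellerFamily P H') {x y : ∀ i, X i} {k : Fin d}
    (hS : ∀ b, Function.update x k b ∈ polyUnion H ↔ Function.update y k b ∈ polyUnion H')
    {b' : X k} (hb' : Function.update x k b' ∉ polyUnion H)
    {b : X k} {K : ∀ i, Set (X i)} (hK : K ∈ H)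
    (hx : Function.update x k b ∈ boxSet K) {ρ : Set (Set (X k))} (hρ : ρ ∈ P k)
    (hKρ : K k ∈ ρ) {L : ∀ i, Set (X i)} (hL : L ∈ H') {c : X k}
    (hc : Function.update y k c ∈ boxSet L) : L k ∈ ρ := by
  have hK1 : K k ≠ Set.univ := by
    intro h
    exact hb' (mem_poly.2 ⟨K, hK, update_box hx (by rw [h]; trivial)⟩)
  have hL1 : L k ≠ Set.univ := by
    intro h
    exact hb' ((hS b').2 (mem_poly.2 ⟨L, hL, update_box hc (by rw [h]; trivial)⟩))
  obtain ⟨ρ', hρ', hLρ'⟩ := hH'.2.1 L hL k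
  by_cases hne : ρ = ρ'
  · rw [hne]; exact hLρ'
  exfalso
  have : {b | Function.update x k b ∈ polyUnion H} = Set.univ := by
    apply sat_eq hsys hρ hρ' hne ⟨b, mem_poly.2 ⟨K, hK, hx⟩⟩
    · intro D hD e he heS f hf
      obtain ⟨M, hM, hMe⟩ := mem_poly.1 heS
      have hMρ := fiber_sat hsys hH hK hx hρ hKρ hK1 hM hMe
      have : D = M k := part_eq hsys hρ hD hMρ he (by simpa using mem_boxSet.1 hMe k)
      exact mem_poly.2 ⟨M, hM, update_box hMe (this ▸ hf)⟩
    · intro D hD e he heS f hf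
      obtain ⟨M, hM, hMe⟩ := mem_poly.1 ((hS e).1 heS)
      have hMρ := fiber_sat hsys hH' hL hc hρ' hLρ' hL1 hM hMe
      have : D = M k := part_eq hsys hρ' hD hMρ he (by simpa using mem_boxSet.1 hMe k)
      exact (hS f).2 (mem_poly.2 ⟨M, hM, update_box hMe (this ▸ hf)⟩)
  exact hb' (by have h : b' ∈ {b | Function.update x k b ∈ polyUnion H} := by
                  rw [this]; trivial
                exact h)

lemma dichotomy (hsys : IsBoxSystem X P) {G : Set (∀ i, Set (X i))} (hG : IsKellerFamily P G)
    {i k : Fin d} (hik : i ≠ k) {π : Set (Set (X i))} {ρ : Set (Set (X k))}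
    (hπ : HiddenIn P G i π) (hρ : HiddenIn P G k ρ) (x : ∀ j, X j) {a a' : X i} {b b' : X k}
    (ha : Function.update x i a ∉ polyUnion (restrictFam G k ρ))
    (ha' : Function.update x i a' ∈ polyUnion (restrictFam G k ρ))
    (hb : Function.update x k b ∈ polyUnion (restrictFam G i π))
    (hb' : Function.update x k b' ∉ polyUnion (restrictFam G i π)) : False := by
  have key : ∀ (a : X i) (b : X k), Function.update (Function.update x i a) k b ∈
      polyUnion (restrictFam G i π) ↔ Function.update x k b ∈ polyUnion (restrictFam G i π) := by
    intro a b
    rw [Function.update_comm hik]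
    exact cyl_iff hπ.2.2.2 _ _
  obtain ⟨K, hK, hKx⟩ := mem_poly.1 ((key a' b).2 hb)
  obtain ⟨L, hL, hLx⟩ := mem_poly.1 ((key a b).2 hb)
  obtain ⟨M, hM, hMx⟩ := mem_poly.1 ((cyl_iff hρ.2.2.2 _ b).2 ha')
  have hKM : K = M := box_unique hsys hG hK.1 hM.1 hKx hMx
  have hLρ : L k ∈ ρ := by
    apply fiber_eq hsys hπ.2.2.1 hπ.2.2.1 (x := Function.update x i a')
      (y := Function.update x i a) (b' := b') _ _ hK hKx hρ.1 _ hL hLx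
    · intro b; rw [key, key]
    · rw [key]; exact hb'
    · rw [hKM]; exact hM.2
  apply ha
  rw [← cyl_iff hρ.2.2.2 _ b]
  exact mem_poly.2 ⟨L, ⟨hL.1, hLρ⟩, hLx⟩

/-! ### Piles -/

lemma exists_other (hsys : IsBoxSystem X P) {i : Fin d} {π : Set (Set (X i))} (hπ : π ∈ P i)
    (hnt : π ≠ {Set.univ}) {A : Set (X i)} (h1 : A ∈ π) : ∃ x, x ∉ A := by
  by_contra h
  push Not at h
  exact ne_univ hsys hπ hnt h1 (Set.eq_univ_of_forall h)

lemma hidden_sub (hsys : IsBoxSystem X P) {G : Set (∀ i, Set (X i))}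
    (hG : IsKellerFamily P G) {i : Fin d} {π : Set (Set (X i))} (hπ : π ∈ P i)
    (hlam : restrictFam G i π = G)
    {k : Fin d} (hk : k ≠ i) {ρ : Set (Set (X k))} (hρ : HiddenIn P G k ρ) :
    ∃ A ∈ π, HiddenIn P (restrictFam G i {A}) k ρ := by
  obtain ⟨K, hK⟩ := hρ.2.2.1.1
  have hlam' : ∀ L ∈ G, L i ∈ π := fun L hL => by rw [← hlam] at hL; exact hL.2
  refine ⟨K i, hlam' K hK.1, hρ.1, hρ.2.1, ?_, ?_⟩
  · exact keller_sub hG (fun L hL => hL.1.1) ⟨K, ⟨hK.1, rfl⟩, hK.2⟩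
  · intro y hy b
    obtain ⟨L, hL, hLy⟩ := mem_poly.1 hy
    have := hρ.2.2.2 y (mem_poly.2 ⟨L, ⟨hL.1.1, hL.2⟩, hLy⟩) b
    obtain ⟨M, hM, hMy⟩ := mem_poly.1 this
    refine mem_poly.2 ⟨M, ⟨⟨hM.1, ?_⟩, hM.2⟩, hMy⟩
    have e1 := mem_boxSet.1 hMy i
    have e2 := mem_boxSet.1 hLy i
    rw [Function.update_of_ne hk.symm] at e1
    have e3 : L i = K i := hL.1.2
    rw [e3] at e2
    exact part_eq hsys hπ (hlam' M hM.1) (hlam' K hK.1) e1 e2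

lemma hidden_up (hsys : IsBoxSystem X P) {G : Set (∀ i, Set (X i))}
    (hG : IsKellerFamily P G) {i : Fin d} {π : Set (Set (X i))} (hπ : π ∈ P i)
    (hlam : restrictFam G i π = G) (hcyl : IsCylinder i (polyUnion G))
    {k : Fin d} (hk : k ≠ i) {ρ : Set (Set (X k))} {A : Set (X i)} (hA : A ∈ π)
    (hρ : HiddenIn P (restrictFam G i {A}) k ρ) : HiddenIn P G k ρ := by
  have hlam' : ∀ L ∈ G, L i ∈ π := fun L hL => by rw [← hlam] at hL; exact hL.2
  obtain ⟨K, hK⟩ := hρ.2.2.1.1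
  refine ⟨hρ.1, hρ.2.1, keller_sub hG (fun L hL => hL.1) ⟨K, hK.1.1, hK.2⟩, ?_⟩
  intro y hy c
  obtain ⟨L, hL, hLy⟩ := mem_poly.1 hy
  have hLne := ne_univ hsys hρ.1 hρ.2.1 hL.2
  by_cases hc : Function.update y k c ∈ polyUnion G
  · obtain ⟨M, hM, hMc⟩ := mem_poly.1 hc
    have hLy' : Function.update y k (y k) ∈ boxSet L := by simpa using hLy
    exact mem_poly.2 ⟨M, ⟨hM, fiber_sat hsys hG hL.1 hLy' hρ.1 hL.2 hLne hM hMc⟩, hMc⟩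
  exfalso
  obtain ⟨a, ha⟩ := (hsys.2.2.2.1 i π hπ).1 A hA
  have hLy' : Function.update y k (y k) ∈ boxSet L := by simpa using hLy
  have key : ∀ b, Function.update (Function.update y i a) k b ∈ polyUnion G ↔
      Function.update y k b ∈ polyUnion G := by
    intro b
    rw [Function.update_comm hk.symm]
    exact cyl_iff hcyl _ _
  have h1 : Function.update (Function.update y i a) k (y k) ∈ polyUnion G := by
    rw [key]; exact mem_poly.2 ⟨L, hL.1, hLy'⟩
  obtain ⟨M, hM, hMy⟩ := mem_poly.1 h1
  have hMρ : M k ∈ ρ := fiber_eq hsys hG hG (fun b => (key b).symm) hc hL.1 hLy' hρ.1 hL.2 hM hMy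
  have hMA : M i = A := by
    have e1 := mem_boxSet.1 hMy i
    rw [Function.update_of_ne hk.symm] at e1
    simp only [Function.update_self] at e1
    exact part_eq hsys hπ (hlam' M hM) hA e1 ha
  have h2 := hρ.2.2.2 _ (mem_poly.2 ⟨M, ⟨⟨hM, hMA⟩, hMρ⟩, hMy⟩) c
  rw [Function.update_idem] at h2
  obtain ⟨N, hN, hNy⟩ := mem_poly.1 h2
  exact hc ((key c).1 (mem_poly.2 ⟨N, hN.1.1, hNy⟩))

lemma hidden_self (hsys : IsBoxSystem X P) {G : Set (∀ i, Set (X i))}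
    (hG : IsKellerFamily P G) {i : Fin d} {π : Set (Set (X i))} (hπ : π ∈ P i)
    (hnt : π ≠ {Set.univ})
    (hlam : restrictFam G i π = G) (hcyl : IsCylinder i (polyUnion G)) (ρ : Set (Set (X i))) :
    HiddenIn P G i ρ ↔ ρ = π := by
  constructor
  · intro h
    obtain ⟨K, hK⟩ := h.2.2.1.1
    have hKπ : K i ∈ π := by
      have := hK.1
      rw [← hlam] at this
      exact this.2
    exact part_unique hsys h.1 hπ hK.2 hKπ (ne_univ hsys hπ hnt hKπ)
  · rintro rfl
    refine ⟨hπ, hnt, ?_, ?_⟩ <;> rw [hlam]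
    · exact hG
    · exact hcyl

lemma hidden_part (hsys : IsBoxSystem X P) {G : Set (∀ i, Set (X i))}
    {i : Fin d} {π : Set (Set (X i))} (hπ : π ∈ P i)
    (hnt : π ≠ {Set.univ}) {A : Set (X i)} (hA : A ∈ π) (ρ : Set (Set (X i))) :
    ¬ HiddenIn P (restrictFam G i {A}) i ρ := by
  intro h
  obtain ⟨K, hK⟩ := h.2.2.1.1
  obtain ⟨x, hx⟩ := box_nonempty hsys (h.2.2.1.2.1 K hK)
  obtain ⟨b, hb⟩ := exists_other hsys hπ hnt hA
  obtain ⟨M, hM, hMy⟩ := mem_poly.1 (h.2.2.2 x (mem_poly.2 ⟨K, hK, hx⟩) b)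
  have := mem_boxSet.1 hMy i
  rw [Function.update_self, show M i = A from hM.1.2] at this
  exact hb this

open Classical in
lemma cIdx_eq (hsys : IsBoxSystem X P) (G : Set (∀ i, Set (X i))) (i : Fin d) :
    cIdx P G i = ∑ ρ ∈ (hsys.2.1 i).toFinset, if HiddenIn P G i ρ then ρ.ncard - 1 else 0 := by
  unfold cIdx
  have : hiddenSet P G i =
      ((((hsys.2.1 i).toFinset).filter (fun ρ => HiddenIn P G i ρ) : Finset _) : Set _) := by
    ext ρ
    simp only [hiddenSet, Set.mem_setOf_eq, Finset.coe_filter, Set.Finite.mem_toFinset]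
    exact ⟨fun h => ⟨h.1, h⟩, fun h => h.2⟩
  rw [this, finsum_mem_coe_finset, Finset.sum_filter]

lemma nontriv_card (hsys : IsBoxSystem X P) {i : Fin d} {π : Set (Set (X i))} (hπ : π ∈ P i)
    (hnt : π ≠ {Set.univ}) : 2 ≤ π.ncard := by
  have := hsys.1 i
  obtain ⟨x⟩ : Nonempty (X i) := inferInstance
  obtain ⟨A, hA, -⟩ := exists_part hsys hπ x
  obtain ⟨b, hb⟩ := exists_other hsys hπ hnt hA
  obtain ⟨B, hB, hbB⟩ := exists_part hsys hπ b
  have : 1 < π.ncard := by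
    rw [Set.one_lt_ncard (hsys.2.2.1 i π hπ)]
    exact ⟨A, hA, B, hB, fun h => hb (h ▸ hbB)⟩
  omega

lemma pile_card (hsys : IsBoxSystem X P) {G : Set (∀ i, Set (X i))} (hfin : G.Finite)
    {i : Fin d} {π : Set (Set (X i))} (hπ : π ∈ P i)
    (hlam : restrictFam G i π = G) :
    G.ncard = ∑ A ∈ (hsys.2.2.1 i π hπ).toFinset, (restrictFam G i {A}).ncard := by
  classical
  have hlam' : ∀ L ∈ G, L i ∈ π := fun L hL => by rw [← hlam] at hL; exact hL.2
  rw [Set.ncard_eq_toFinset_card G hfin,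
    Finset.card_eq_sum_card_fiberwise (f := fun K => K i) (t := (hsys.2.2.1 i π hπ).toFinset)]
  · apply Finset.sum_congr rfl
    intro A _
    rw [← Set.ncard_coe_finset]
    congr 1
    ext K
    simp [restrictFam]
  · intro K hK
    simp only [Set.Finite.coe_toFinset] at hK ⊢
    exact hlam' K hK

open Classical in
lemma pile_term (hsys : IsBoxSystem X P) {G : Set (∀ i, Set (X i))}
    (hG : IsKellerFamily P G) {i : Fin d} {π : Set (Set (X i))} (hπ : π ∈ P i)
    (hlam : restrictFam G i π = G)
    {k : Fin d} (hk : k ≠ i) (ρ : Set (Set (X k))) :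
    (if HiddenIn P G k ρ then ρ.ncard - 1 else 0) ≤
      ∑ A ∈ (hsys.2.2.1 i π hπ).toFinset,
        if HiddenIn P (restrictFam G i {A}) k ρ then ρ.ncard - 1 else 0 := by
  split_ifs with h
  · obtain ⟨A, hA, hA'⟩ := hidden_sub hsys hG hπ hlam hk h
    calc ρ.ncard - 1 = (if HiddenIn P (restrictFam G i {A}) k ρ then ρ.ncard - 1 else 0) := by
          rw [if_pos hA']
      _ ≤ _ := Finset.single_le_sum
          (f := fun A => if HiddenIn P (restrictFam G i {A}) k ρ then ρ.ncard - 1 else 0)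
          (fun _ _ => Nat.zero_le _) (by simpa using hA)
  · exact Nat.zero_le _

lemma pile_idx_self (hsys : IsBoxSystem X P) {G : Set (∀ i, Set (X i))}
    (hG : IsKellerFamily P G) {i : Fin d} {π : Set (Set (X i))} (hπ : π ∈ P i)
    (hnt : π ≠ {Set.univ})
    (hlam : restrictFam G i π = G) (hcyl : IsCylinder i (polyUnion G)) :
    cIdx P G i = π.ncard - 1 := by
  classical
  rw [cIdx_eq hsys]
  simp only [hidden_self hsys hG hπ hnt hlam hcyl]
  rw [Finset.sum_ite_eq' ]
  simp [hπ]

lemma pile_idx_part (hsys : IsBoxSystem X P) {G : Set (∀ i, Set (X i))}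
    {i : Fin d} {π : Set (Set (X i))} (hπ : π ∈ P i)
    (hnt : π ≠ {Set.univ}) {A : Set (X i)} (hA : A ∈ π) :
    cIdx P (restrictFam G i {A}) i = 0 := by
  classical
  rw [cIdx_eq hsys]
  simp [hidden_part hsys hπ hnt hA]

lemma pile_idx_le (hsys : IsBoxSystem X P) {G : Set (∀ i, Set (X i))}
    (hG : IsKellerFamily P G) {i : Fin d} {π : Set (Set (X i))} (hπ : π ∈ P i)
    (hlam : restrictFam G i π = G) {k : Fin d} (hk : k ≠ i) :
    cIdx P G k ≤ ∑ A ∈ (hsys.2.2.1 i π hπ).toFinset, cIdx P (restrictFam G i {A}) k := by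
  classical
  simp only [cIdx_eq hsys]
  rw [Finset.sum_comm]
  exact Finset.sum_le_sum fun ρ _ => pile_term hsys hG hπ hlam hk ρ

lemma pile_idx_eq (hsys : IsBoxSystem X P) {G : Set (∀ i, Set (X i))}
    (hG : IsKellerFamily P G) {i : Fin d} {π : Set (Set (X i))} (hπ : π ∈ P i)
    (hlam : restrictFam G i π = G) (hcyl : IsCylinder i (polyUnion G))
    {k : Fin d} (hk : k ≠ i)
    (hdis : ∀ A ∈ π, ∀ B ∈ π, A ≠ B → ∀ ρ,
          ¬ (HiddenIn P (restrictFam G i {A}) k ρ ∧ HiddenIn P (restrictFam G i {B}) k ρ)) :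
    cIdx P G k = ∑ A ∈ (hsys.2.2.1 i π hπ).toFinset, cIdx P (restrictFam G i {A}) k := by
  classical
  simp only [cIdx_eq hsys]
  rw [Finset.sum_comm]
  refine Finset.sum_congr rfl fun ρ _ => ?_
  split_ifs with h
  · obtain ⟨A, hA, hA'⟩ := hidden_sub hsys hG hπ hlam hk h
    rw [Finset.sum_eq_single A]
    · rw [if_pos hA']
    · intro B hB hBA
      rw [if_neg]
      intro hB'
      exact hdis A hA B (by simpa using hB) hBA.symm ρ ⟨hA', hB'⟩
    · intro h; simp [hA] at h
  · symm
    apply Finset.sum_eq_zero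
    intro A hA
    rw [if_neg]
    intro hA'
    exact h (hidden_up hsys hG hπ hlam hcyl hk (by simpa using hA) hA')

lemma pile_idx_dis (hsys : IsBoxSystem X P) {G : Set (∀ i, Set (X i))}
    (hG : IsKellerFamily P G) {i : Fin d} {π : Set (Set (X i))} (hπ : π ∈ P i)
    (hlam : restrictFam G i π = G)
    {k : Fin d} (hk : k ≠ i)
    (heq : cIdx P G k = ∑ A ∈ (hsys.2.2.1 i π hπ).toFinset, cIdx P (restrictFam G i {A}) k) :
    ∀ A ∈ π, ∀ B ∈ π, A ≠ B → ∀ ρ,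
          ¬ (HiddenIn P (restrictFam G i {A}) k ρ ∧ HiddenIn P (restrictFam G i {B}) k ρ) := by
  classical
  intro A hA B hB hAB ρ ⟨h1, h2⟩
  simp only [cIdx_eq hsys] at heq
  rw [Finset.sum_comm] at heq
  have := (Finset.sum_eq_sum_iff_of_le
    (fun ρ _ => pile_term hsys hG hπ hlam hk ρ)).1 heq ρ (by simpa using h1.1)
  have hc := nontriv_card hsys h1.1 h1.2.1
  have hle : (if HiddenIn P G k ρ then ρ.ncard - 1 else 0) ≤ ρ.ncard - 1 := by
    split_ifs <;> omega
  have hge : ∑ A ∈ ({A, B} : Finset _),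
        (if HiddenIn P (restrictFam G i {A}) k ρ then ρ.ncard - 1 else 0) ≤
      ∑ A ∈ (hsys.2.2.1 i π hπ).toFinset,
        (if HiddenIn P (restrictFam G i {A}) k ρ then ρ.ncard - 1 else 0) := by
    apply Finset.sum_le_sum_of_subset
    intro C hC
    simp only [Finset.mem_insert, Finset.mem_singleton] at hC
    rcases hC with rfl | rfl <;> simpa
  rw [Finset.sum_pair hAB, if_pos h1, if_pos h2] at hge
  omega

lemma pile_total (hsys : IsBoxSystem X P) {G : Set (∀ i, Set (X i))}
    {i : Fin d} {π : Set (Set (X i))} (hπ : π ∈ P i) (hnt : π ≠ {Set.univ}) :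
    ∑ A ∈ (hsys.2.2.1 i π hπ).toFinset, cTotal P (restrictFam G i {A}) =
      ∑ k ∈ Finset.univ.erase i,
        ∑ A ∈ (hsys.2.2.1 i π hπ).toFinset, cIdx P (restrictFam G i {A}) k := by
  classical
  unfold cTotal
  rw [Finset.sum_comm, ← Finset.add_sum_erase _ _ (Finset.mem_univ i)]
  rw [Finset.sum_eq_zero, zero_add]
  intro A hA
  exact pile_idx_part hsys hπ hnt (by simpa using hA)

lemma multipile_eq (hsys : IsBoxSystem X P) {G : Set (∀ i, Set (X i))} (h : IsMultipile P G)
    (hfin : G.Finite) : cTotal P G + 1 = G.ncard := by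
  classical
  induction h with
  | single K hK =>
    rw [Set.ncard_singleton]
    simp only [Nat.add_eq_right]
    unfold cTotal
    apply Finset.sum_eq_zero
    intro k _
    rw [cIdx_eq hsys]
    apply Finset.sum_eq_zero
    intro ρ _
    rw [if_neg]
    intro h
    have e : restrictFam ({K} : Set (∀ i, Set (X i))) k {K k} = {K} := by
      ext L
      simp only [restrictFam, Set.mem_singleton_iff, Set.mem_setOf_eq, and_iff_left_iff_imp]
      rintro rfl; rfl
    rw [← e] at h
    obtain ⟨L, hL⟩ := h.2.2.1.1
    have hLK : L = K := hL.1.1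
    exact hidden_part hsys h.1 h.2.1 (hLK ▸ hL.2) ρ h
  | pile G i π hπ hnt hK hlam hcyl hsub hdis ih =>
    have ih' : ∀ A ∈ (hsys.2.2.1 i π hπ).toFinset,
        cTotal P (restrictFam G i {A}) + 1 = (restrictFam G i {A}).ncard := by
      intro A hA
      exact ih A (by simpa using hA) (hfin.subset fun K hK => hK.1)
    rw [pile_card hsys hfin hπ hlam, ← Finset.sum_congr rfl ih', Finset.sum_add_distrib,
      pile_total hsys hπ hnt]
    unfold cTotal
    rw [← Finset.add_sum_erase _ _ (Finset.mem_univ i), pile_idx_self hsys hK hπ hnt hlam hcyl]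
    have hc := nontriv_card hsys hπ hnt
    have hcard : π.ncard = ((hsys.2.2.1 i π hπ).toFinset).card :=
      Set.ncard_eq_toFinset_card _ _
    rw [Finset.sum_congr rfl fun k hk => pile_idx_eq hsys hK hπ hlam hcyl
      (Finset.ne_of_mem_erase hk) (hdis k (Finset.ne_of_mem_erase hk))]
    simp only [Finset.sum_const, smul_eq_mul, mul_one]
    omega

lemma restrict_nonempty (hsys : IsBoxSystem X P) {G : Set (∀ i, Set (X i))}
    (hG : IsKellerFamily P G) {i : Fin d} {π : Set (Set (X i))} (hπ : π ∈ P i)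
    (hlam : restrictFam G i π = G) (hcyl : IsCylinder i (polyUnion G))
    {A : Set (X i)} (hA : A ∈ π) : (restrictFam G i {A}).Nonempty := by
  have hlam' : ∀ L ∈ G, L i ∈ π := fun L hL => by rw [← hlam] at hL; exact hL.2
  obtain ⟨K, hK⟩ := hG.1
  obtain ⟨x, hx⟩ := box_nonempty hsys (hG.2.1 K hK)
  obtain ⟨a, ha⟩ := (hsys.2.2.2.1 i π hπ).1 A hA
  obtain ⟨L, hL, hLx⟩ := mem_poly.1 (hcyl x (mem_poly.2 ⟨K, hK, hx⟩) a)
  refine ⟨L, hL, ?_⟩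
  have := mem_boxSet.1 hLx i
  rw [Function.update_self] at this
  exact part_eq hsys hπ (hlam' L hL) hA this ha

/-- The structural part: from the general bound and the existence of a laminating partition. -/
lemma multipile_of_eq (hsys : IsBoxSystem X P)
    (hbound : ∀ G : Set (∀ i, Set (X i)), IsKellerFamily P G → G.Finite →
      cTotal P G + 1 ≤ G.ncard)
    (hpile : ∀ G : Set (∀ i, Set (X i)), IsKellerFamily P G → G.Finite →
      cTotal P G + 1 = G.ncard → 2 ≤ G.ncard →
      ∃ i, ∃ π, HiddenIn P G i π ∧ restrictFam G i π = G) (n : ℕ) :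
    ∀ G : Set (∀ i, Set (X i)), IsKellerFamily P G → G.Finite → G.ncard = n →
      cTotal P G + 1 = G.ncard → IsMultipile P G := by
  classical
  induction n using Nat.strong_induction_on with
  | _ n ih =>
  intro G hG hfin hn hc
  by_cases h2 : 2 ≤ G.ncard
  swap
  · have h1 : G.ncard = 1 := by omega
    obtain ⟨K, rfl⟩ := Set.ncard_eq_one.1 h1
    exact IsMultipile.single K (hG.2.1 K rfl)
  obtain ⟨i, π, hh, hlam⟩ := hpile G hG hfin hc h2
  have hπ := hh.1
  have hnt := hh.2.1
  have hcyl : IsCylinder i (polyUnion G) := by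
    have := hh.2.2.2
    rwa [hlam] at this
  have hfinA : ∀ A, (restrictFam G i {A}).Finite := fun A => hfin.subset fun K hK => hK.1
  have hKA : ∀ A ∈ π, IsKellerFamily P (restrictFam G i {A}) := fun A hA =>
    keller_sub hG (fun K hK => hK.1) (restrict_nonempty hsys hG hπ hlam hcyl hA)
  have hle : ∀ A ∈ (hsys.2.2.1 i π hπ).toFinset,
      cTotal P (restrictFam G i {A}) + 1 ≤ (restrictFam G i {A}).ncard := fun A hA =>
    hbound _ (hKA A (by simpa using hA)) (hfinA A)
  have hle2 : ∀ k ∈ Finset.univ.erase i, cIdx P G k ≤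
      ∑ A ∈ (hsys.2.2.1 i π hπ).toFinset, cIdx P (restrictFam G i {A}) k := fun k hk =>
    pile_idx_le hsys hG hπ hlam (Finset.ne_of_mem_erase hk)
  have hcard2 := nontriv_card hsys hπ hnt
  have hcard : π.ncard = ((hsys.2.2.1 i π hπ).toFinset).card := Set.ncard_eq_toFinset_card _ _
  have hGc := pile_card hsys hfin hπ hlam
  have hct : cTotal P G = (π.ncard - 1) + ∑ k ∈ Finset.univ.erase i, cIdx P G k := by
    unfold cTotal
    rw [← Finset.add_sum_erase _ _ (Finset.mem_univ i), pile_idx_self hsys hG hπ hnt hlam hcyl]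
  have hs1 := Finset.sum_le_sum hle
  have hs2 := Finset.sum_le_sum hle2
  have hpt := pile_total hsys (G := G) hπ hnt
  have hs1' := hs1
  rw [Finset.sum_add_distrib] at hs1'
  simp only [Finset.sum_const, smul_eq_mul, mul_one] at hs1'
  have heq1 := (Finset.sum_eq_sum_iff_of_le hle).1 (by
    rw [Finset.sum_add_distrib]
    simp only [Finset.sum_const, smul_eq_mul, mul_one]
    omega)
  have heq2 := (Finset.sum_eq_sum_iff_of_le hle2).1 (by omega)
  refine IsMultipile.pile G i π hπ hnt hG hlam hcyl ?_ ?_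
  · intro A hA
    refine ih _ ?_ _ (hKA A hA) (hfinA A) rfl (heq1 A (by simpa using hA))
    rw [← hn]
    apply Set.ncard_lt_ncard _ hfin
    refine ⟨fun K hK => hK.1, fun hsub => ?_⟩
    obtain ⟨b, hb⟩ := exists_other hsys hπ hnt hA
    obtain ⟨B, hB, hbB⟩ := exists_part hsys hπ b
    obtain ⟨K, hK⟩ := restrict_nonempty hsys hG hπ hlam hcyl hB
    have e1 : K i = A := (hsub hK.1).2
    have e2 : K i = B := hK.2
    exact hb (by rw [← e1, e2]; exact hbB)
  · intro k hk
    exact pile_idx_dis hsys hG hπ hlam hk (heq2 k (by simpa using hk))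

end Aux

section Analysis

variable {d : ℕ} {X : Fin d → Type*} {P : ∀ i, Set (Set (Set (X i)))}

open Classical in
/-- Real-valued indicator. -/
noncomputable def ind {α : Type*} (A : Set α) (a : α) : ℝ := if a ∈ A then 1 else 0

lemma ind_pos {α : Type*} {A : Set α} {a : α} (h : a ∈ A) : ind A a = 1 := if_pos h
lemma ind_neg {α : Type*} {A : Set α} {a : α} (h : a ∉ A) : ind A a = 0 := if_neg h
lemma ind_nonneg {α : Type*} (A : Set α) (a : α) : 0 ≤ ind A a := by
  unfold ind; split_ifs <;> norm_num
lemma ind_le_one {α : Type*} (A : Set α) (a : α) : ind A a ≤ 1 := by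
  unfold ind; split_ifs <;> norm_num
lemma ind_mul_self {α : Type*} (A : Set α) (a : α) : ind A a * ind A a = ind A a := by
  unfold ind; split_ifs <;> norm_num

/-- A finitely supported product probability measure charging all parts. -/
structure Wt (X : Fin d → Type*) (P : ∀ i, Set (Set (Set (X i)))) where
  F : ∀ i, Finset (X i)
  w : ∀ i, X i → ℝ
  pos : ∀ i, ∀ x ∈ F i, 0 < w i x
  sum1 : ∀ i, ∑ x ∈ F i, w i x = 1
  meets : ∀ i, ∀ π ∈ P i, ∀ A ∈ π, ∃ x ∈ F i, x ∈ A

/-- Expectation. -/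
noncomputable def Wt.E (μ : Wt X P) : ((∀ i, X i) → ℝ) →ₗ[ℝ] ℝ :=
  ∑ x ∈ Fintype.piFinset μ.F, (∏ i, μ.w i (x i)) • LinearMap.proj x

lemma Wt.E_apply (μ : Wt X P) (f : (∀ i, X i) → ℝ) :
    μ.E f = ∑ x ∈ Fintype.piFinset μ.F, (∏ i, μ.w i (x i)) * f x := by
  simp [Wt.E, LinearMap.sum_apply]

/-- Expectation in one coordinate. -/
noncomputable def Wt.E1 (μ : Wt X P) (i : Fin d) (f : (∀ i, X i) → ℝ) : (∀ i, X i) → ℝ :=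
  fun x => ∑ a ∈ μ.F i, μ.w i a * f (Function.update x i a)

lemma Wt.prod_pos (μ : Wt X P) {x : ∀ i, X i} (hx : ∀ i, x i ∈ μ.F i) :
    0 < ∏ i, μ.w i (x i) := Finset.prod_pos fun i _ => μ.pos i _ (hx i)

lemma Wt.E_nonneg (μ : Wt X P) {f : (∀ i, X i) → ℝ} (hf : ∀ x, 0 ≤ f x) : 0 ≤ μ.E f := by
  rw [μ.E_apply]
  exact Finset.sum_nonneg fun x hx =>
    mul_nonneg (μ.prod_pos (Fintype.mem_piFinset.1 hx)).le (hf x)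

lemma Wt.E_mono (μ : Wt X P) {f g : (∀ i, X i) → ℝ} (hf : ∀ x, f x ≤ g x) : μ.E f ≤ μ.E g := by
  have := μ.E_nonneg (f := g - f) (fun x => sub_nonneg.2 (hf x))
  rw [map_sub] at this
  linarith

lemma Wt.le_E (μ : Wt X P) {f : (∀ i, X i) → ℝ} (hf : ∀ x, 0 ≤ f x) {x : ∀ i, X i}
    (hx : ∀ i, x i ∈ μ.F i) : (∏ i, μ.w i (x i)) * f x ≤ μ.E f := by
  rw [μ.E_apply]
  exact Finset.single_le_sum (f := fun x => (∏ i, μ.w i (x i)) * f x) (fun y hy =>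
    mul_nonneg (μ.prod_pos (Fintype.mem_piFinset.1 hy)).le (hf y)) (Fintype.mem_piFinset.2 hx)

lemma Wt.E_one (μ : Wt X P) : μ.E (fun _ => 1) = 1 := by
  rw [μ.E_apply]
  simp only [mul_one]
  rw [← Finset.prod_univ_sum]
  simp [μ.sum1]

lemma Wt.E_E1 (μ : Wt X P) (i : Fin d) (f : (∀ i, X i) → ℝ) : μ.E (μ.E1 i f) = μ.E f := by
  have key : ∀ (x : ∀ i, X i) (a : X i), (∏ j, μ.w j (Function.update x i a j)) * μ.w i (x i) =
      (∏ j, μ.w j (x j)) * μ.w i a := by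
    intro x a
    rw [← Finset.mul_prod_erase _ _ (Finset.mem_univ i),
      ← Finset.mul_prod_erase _ (fun j => μ.w j (x j)) (Finset.mem_univ i)]
    have : ∏ j ∈ Finset.univ.erase i, μ.w j (Function.update x i a j) =
        ∏ j ∈ Finset.univ.erase i, μ.w j (x j) := by
      refine Finset.prod_congr rfl fun j hj => ?_
      rw [Function.update_of_ne (Finset.ne_of_mem_erase hj)]
    rw [this, Function.update_self]
    ring
  rw [μ.E_apply, μ.E_apply]
  have h1 : ∑ x ∈ Fintype.piFinset μ.F, (∏ j, μ.w j (x j)) * f x =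
      ∑ z ∈ Fintype.piFinset μ.F ×ˢ μ.F i, (∏ j, μ.w j (z.1 j)) * μ.w i z.2 * f z.1 := by
    rw [Finset.sum_product]
    refine Finset.sum_congr rfl fun x _ => ?_
    simp only
    rw [← Finset.sum_mul, ← Finset.mul_sum, μ.sum1, mul_one]
  have h2 : ∑ x ∈ Fintype.piFinset μ.F, (∏ j, μ.w j (x j)) * μ.E1 i f x =
      ∑ z ∈ Fintype.piFinset μ.F ×ˢ μ.F i,
        (∏ j, μ.w j (z.1 j)) * μ.w i z.2 * f (Function.update z.1 i z.2) := by
    rw [Finset.sum_product]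
    refine Finset.sum_congr rfl fun x _ => ?_
    simp only [Wt.E1, Finset.mul_sum, mul_assoc]
  rw [h1, h2]
  have hmem : ∀ z ∈ Fintype.piFinset μ.F ×ˢ μ.F i,
      (Function.update z.1 i z.2, z.1 i) ∈ Fintype.piFinset μ.F ×ˢ μ.F i := by
    rintro ⟨x, a⟩ hz
    rw [Finset.mem_product, Fintype.mem_piFinset] at hz ⊢
    refine ⟨fun j => ?_, hz.1 i⟩
    by_cases hj : j = i
    · subst hj; simpa using hz.2
    · simpa [hj] using hz.1 j
  refine Finset.sum_nbij' (fun z => (Function.update z.1 i z.2, z.1 i))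
    (fun z => (Function.update z.1 i z.2, z.1 i)) hmem hmem ?_ ?_ ?_
  · rintro ⟨x, a⟩ _; simp
  · rintro ⟨x, a⟩ _; simp
  · rintro ⟨x, a⟩ _
    simp only
    rw [key]

/-- Mass of a set in coordinate `i`. -/
noncomputable def Wt.m (μ : Wt X P) (i : Fin d) (A : Set (X i)) : ℝ :=
  ∑ a ∈ μ.F i, μ.w i a * ind A a

lemma Wt.le_m (μ : Wt X P) (i : Fin d) {A : Set (X i)} {a : X i} (ha : a ∈ μ.F i) (haA : a ∈ A) :
    μ.w i a ≤ μ.m i A := by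
  have := Finset.single_le_sum (f := fun a => μ.w i a * ind A a) (s := μ.F i) (fun b hb =>
    mul_nonneg (μ.pos i b hb).le (ind_nonneg A b)) ha
  simp only [ind_pos haA, mul_one] at this
  exact this

lemma Wt.m_le_one (μ : Wt X P) (i : Fin d) (A : Set (X i)) : μ.m i A ≤ 1 := by
  rw [← μ.sum1 i]
  refine Finset.sum_le_sum fun a ha => ?_
  have := μ.pos i a ha
  nlinarith [ind_le_one A a]

lemma Wt.m_pos (μ : Wt X P) (i : Fin d) {π : Set (Set (X i))} (hπ : π ∈ P i) {A : Set (X i)}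
    (hA : A ∈ π) : 0 < μ.m i A := by
  obtain ⟨x, hx, hxA⟩ := μ.meets i π hπ A hA
  exact (μ.pos i x hx).trans_le (μ.le_m i hx hxA)

lemma Wt.E_cyl (μ : Wt X P) {i : Fin d} {W : Set (∀ j, X j)} (hW : IsCylinder i W)
    (h : X i → ℝ) : μ.E (fun x => ind W x * h (x i)) =
      μ.E (ind W) * ∑ a ∈ μ.F i, μ.w i a * h a := by
  rw [← μ.E_E1 i]
  have : μ.E1 i (fun x => ind W x * h (x i)) = (∑ a ∈ μ.F i, μ.w i a * h a) • ind W := by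
    ext x
    simp only [Wt.E1, Function.update_self, Pi.smul_apply, smul_eq_mul, Finset.sum_mul]
    refine Finset.sum_congr rfl fun a _ => ?_
    have : ind W (Function.update x i a) = ind W x := by
      by_cases hx : x ∈ W
      · rw [ind_pos hx, ind_pos ((cyl_iff hW x a).2 hx)]
      · rw [ind_neg hx, ind_neg (fun h => hx ((cyl_iff hW x a).1 h))]
    rw [this]; ring
  rw [this, map_smul, smul_eq_mul, mul_comm]

lemma Wt.sum_t (μ : Wt X P) (i : Fin d) {A : Set (X i)} (hA : 0 < μ.m i A) :
    ∑ a ∈ μ.F i, μ.w i a * (ind A a / μ.m i A - 1) = 0 := by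
  have : ∑ a ∈ μ.F i, μ.w i a * (ind A a / μ.m i A - 1) =
      (∑ a ∈ μ.F i, μ.w i a * ind A a) / μ.m i A - ∑ a ∈ μ.F i, μ.w i a := by
    rw [Finset.sum_div, ← Finset.sum_sub_distrib]
    refine Finset.sum_congr rfl fun a _ => ?_
    ring
  rw [this, μ.sum1]
  change μ.m i A / μ.m i A - 1 = 0
  rw [div_self hA.ne', sub_self]

lemma Wt.sum_tt (μ : Wt X P) (i : Fin d) {A : Set (X i)} (hA : 0 < μ.m i A) :
    ∑ a ∈ μ.F i, μ.w i a * ((ind A a / μ.m i A - 1) * (ind A a / μ.m i A - 1)) =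
      1 / μ.m i A - 1 := by
  have : ∑ a ∈ μ.F i, μ.w i a * ((ind A a / μ.m i A - 1) * (ind A a / μ.m i A - 1)) =
      (∑ a ∈ μ.F i, μ.w i a * ind A a) * (1 / μ.m i A ^ 2 - 2 / μ.m i A) +
        ∑ a ∈ μ.F i, μ.w i a := by
    rw [Finset.sum_mul, ← Finset.sum_add_distrib]
    refine Finset.sum_congr rfl fun a _ => ?_
    have := ind_mul_self A a
    linear_combination (μ.w i a / μ.m i A ^ 2) * this
  rw [this, μ.sum1]
  change μ.m i A * _ + 1 = _
  field_simp
  ring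

lemma Wt.E_orth (hsys : IsBoxSystem X P) (μ : Wt X P) {G : Set (∀ i, Set (X i))}
    (hG : IsKellerFamily P G) {i k : Fin d} (hik : i ≠ k) {π : Set (Set (X i))}
    {ρ : Set (Set (X k))} (hπ : HiddenIn P G i π) (hρ : HiddenIn P G k ρ)
    (t : X i → ℝ) (s : X k → ℝ) (ht : ∑ a ∈ μ.F i, μ.w i a * t a = 0)
    (hs : ∑ a ∈ μ.F k, μ.w k a * s a = 0) :
    μ.E (fun x => (ind (polyUnion (restrictFam G i π)) x * t (x i)) *
      (ind (polyUnion (restrictFam G k ρ)) x * s (x k))) = 0 := by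
  rw [← μ.E_E1 k, ← μ.E_E1 i]
  convert map_zero μ.E
  ext x
  simp only [Pi.zero_apply, Wt.E1, Function.update_self]
  set S : X k → ℝ := fun b => ind (polyUnion (restrictFam G i π)) (Function.update x k b) with hS
  set T : X i → ℝ := fun a => ind (polyUnion (restrictFam G k ρ)) (Function.update x i a) with hT
  have h1 : ∀ a b, ind (polyUnion (restrictFam G i π))
      (Function.update (Function.update x i a) k b) = S b := by
    intro a b
    simp only [hS, ind]
    rw [Function.update_comm hik, cyl_iff hπ.2.2.2]
  have h2 : ∀ a b, ind (polyUnion (restrictFam G k ρ))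
      (Function.update (Function.update x i a) k b) = T a := by
    intro a b
    simp only [hT, ind]
    rw [cyl_iff hρ.2.2.2]
  have h3 : ∀ (a : X i) (b : X k), Function.update (Function.update x i a) k b i = a := by
    intro a b; rw [Function.update_of_ne hik]; simp
  simp only [h1, h2, h3]
  have : ∑ a ∈ μ.F i, μ.w i a * ∑ b ∈ μ.F k, μ.w k b * (S b * t a * (T a * s b)) =
      (∑ a ∈ μ.F i, T a * (μ.w i a * t a)) * (∑ b ∈ μ.F k, S b * (μ.w k b * s b)) := by
    rw [Finset.sum_mul]
    refine Finset.sum_congr rfl fun a _ => ?_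
    rw [Finset.mul_sum, Finset.mul_sum]
    refine Finset.sum_congr rfl fun b _ => ?_
    ring
  rw [this]
  by_cases hTc : ∃ c, ∀ a, T a = c
  · obtain ⟨c, hc⟩ := hTc
    simp only [hc]
    rw [← Finset.mul_sum, ht]; simp
  by_cases hSc : ∃ c, ∀ a, S a = c
  · obtain ⟨c, hc⟩ := hSc
    simp only [hc]
    rw [← Finset.mul_sum, hs]; simp
  exfalso
  push Not at hTc hSc
  obtain ⟨a, ha⟩ := hTc 1
  obtain ⟨a', ha'⟩ := hTc 0
  obtain ⟨b, hb⟩ := hSc 0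
  obtain ⟨b', hb'⟩ := hSc 1
  refine dichotomy hsys hG hik hπ hρ x (a := a) (a' := a') (b := b) (b' := b') ?_ ?_ ?_ ?_
  · intro h; exact ha (ind_pos h)
  · by_contra h; exact ha' (ind_neg h)
  · by_contra h; exact hb (ind_neg h)
  · intro h; exact hb' (ind_pos h)

/-- Pairs (direction, partition). -/
abbrev Pr (X : Fin d → Type*) := Σ i : Fin d, Set (Set (X i))

/-- Cylinder attached to a pair. -/
def WW (G : Set (∀ i, Set (X i))) (s : Pr X) : Set (∀ i, X i) :=
  polyUnion (restrictFam G s.1 s.2)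

open Classical in
/-- All hidden pairs. -/
noncomputable def Hf (hsys : IsBoxSystem X P) (G : Set (∀ i, Set (X i))) : Finset (Pr X) :=
  (Finset.univ.sigma fun i => (hsys.2.1 i).toFinset).filter fun s => HiddenIn P G s.1 s.2

lemma mem_Hf (hsys : IsBoxSystem X P) {G : Set (∀ i, Set (X i))} {s : Pr X} :
    s ∈ Hf hsys G ↔ HiddenIn P G s.1 s.2 := by
  unfold Hf
  simp only [Finset.mem_filter, Finset.mem_sigma, Finset.mem_univ, Set.Finite.mem_toFinset,
    true_and]
  exact ⟨fun h => h.2, fun h => ⟨h.1, h⟩⟩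

lemma cTotal_eq (hsys : IsBoxSystem X P) (G : Set (∀ i, Set (X i))) :
    cTotal P G = ∑ s ∈ Hf hsys G, (s.2.ncard - 1) := by
  classical
  unfold cTotal Hf
  simp only [cIdx_eq hsys]
  rw [Finset.sum_filter, Finset.sum_sigma]

open Classical in
/-- Hidden pairs touching `K`. -/
noncomputable def SK (hsys : IsBoxSystem X P) (G : Set (∀ i, Set (X i))) (K : ∀ i, Set (X i)) :
    Finset (Pr X) := (Hf hsys G).filter fun s => K s.1 ∈ s.2

lemma mem_SK (hsys : IsBoxSystem X P) {G : Set (∀ i, Set (X i))} {K : ∀ i, Set (X i)} {s : Pr X} :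
    s ∈ SK hsys G K ↔ HiddenIn P G s.1 s.2 ∧ K s.1 ∈ s.2 := by
  simp only [SK, Finset.mem_filter, mem_Hf]

/-- Basic functions. -/
noncomputable def phi (μ : Wt X P) (G : Set (∀ i, Set (X i))) (K : ∀ i, Set (X i)) (s : Pr X) :
    (∀ i, X i) → ℝ := fun x =>
  ind (WW G s) x / μ.E (ind (WW G s)) * (ind (K s.1) (x s.1) / μ.m s.1 (K s.1) - 1)

/-- Their squared norms. -/
noncomputable def qq (μ : Wt X P) (G : Set (∀ i, Set (X i))) (K : ∀ i, Set (X i)) (s : Pr X) : ℝ :=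
  (1 / μ.m s.1 (K s.1) - 1) / μ.E (ind (WW G s))

lemma Wt.box_pos (μ : Wt X P) {K : ∀ i, Set (X i)} (hK : IsBox P K) :
    0 < μ.E (ind (boxSet K)) := by
  have : ∀ i, ∃ x ∈ μ.F i, x ∈ K i := by
    intro i
    obtain ⟨π, hπ, h⟩ := hK i
    exact μ.meets i π hπ _ h
  choose x hx hxK using this
  have h := μ.le_E (f := ind (boxSet K)) (ind_nonneg _) hx
  rw [ind_pos (mem_boxSet.2 hxK), mul_one] at h
  exact (μ.prod_pos hx).trans_le h

lemma ind_mono {α : Type*} {A B : Set α} (h : A ⊆ B) (a : α) : ind A a ≤ ind B a := by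
  by_cases ha : a ∈ A
  · rw [ind_pos ha, ind_pos (h ha)]
  · rw [ind_neg ha]; exact ind_nonneg _ _

lemma box_sub {G : Set (∀ i, Set (X i))} {K : ∀ i, Set (X i)} (hK : K ∈ G) :
    boxSet K ⊆ polyUnion G := fun _ hx => mem_poly.2 ⟨K, hK, hx⟩

lemma WW_sub (G : Set (∀ i, Set (X i))) (s : Pr X) : WW G s ⊆ polyUnion G := by
  intro x hx
  obtain ⟨K, hK, h⟩ := mem_poly.1 hx
  exact mem_poly.2 ⟨K, hK.1, h⟩

lemma Wt.poly_pos (μ : Wt X P) {G : Set (∀ i, Set (X i))} (hG : IsKellerFamily P G) :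
    0 < μ.E (ind (polyUnion G)) := by
  obtain ⟨K, hK⟩ := hG.1
  exact (μ.box_pos (hG.2.1 K hK)).trans_le (μ.E_mono (ind_mono (box_sub hK)))

section bessel

variable (hsys : IsBoxSystem X P) (μ : Wt X P) {G : Set (∀ i, Set (X i))}
  {K : ∀ i, Set (X i)}

lemma ind_mul_sub {α : Type*} {A B : Set α} (h : A ⊆ B) (a : α) : ind B a * ind A a = ind A a := by
  by_cases ha : a ∈ A
  · rw [ind_pos ha, ind_pos (h ha)]; norm_num
  · rw [ind_neg ha]; norm_num

lemma E_phi {s : Pr X} (hs : s ∈ SK hsys G K) : μ.E (phi μ G K s) = 0 := by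
  obtain ⟨h1, h2⟩ := (mem_SK hsys).1 hs
  have hm := μ.m_pos s.1 h1.1 h2
  have : phi μ G K s = (1 / μ.E (ind (WW G s))) • fun x =>
      ind (WW G s) x * (fun a => ind (K s.1) a / μ.m s.1 (K s.1) - 1) (x s.1) := by
    ext x; simp only [phi, Pi.smul_apply, smul_eq_mul]; ring
  have key := μ.E_cyl (W := WW G s) h1.2.2.2
    (fun a => ind (K s.1) a / μ.m s.1 (K s.1) - 1)
  rw [μ.sum_t _ hm] at key
  rw [this, map_smul]
  refine (congrArg (fun r : ℝ => (1 / μ.E (ind (WW G s))) • r) key).trans ?_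
  simp

lemma box_sub_WW (hK : K ∈ G) {s : Pr X} (hs : s ∈ SK hsys G K) : boxSet K ⊆ WW G s :=
  box_sub ⟨hK, ((mem_SK hsys).1 hs).2⟩

lemma WW_pos (hG : IsKellerFamily P G) {s : Pr X} (hs : HiddenIn P G s.1 s.2) : 0 < μ.E (ind (WW G s)) :=
  μ.poly_pos hs.2.2.1

lemma E_phi_phi (hG : IsKellerFamily P G) {s : Pr X} (hs : s ∈ SK hsys G K) :
    μ.E (phi μ G K s * phi μ G K s) = qq μ G K s := by
  obtain ⟨h1, h2⟩ := (mem_SK hsys).1 hs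
  have hm := μ.m_pos s.1 h1.1 h2
  have hw := WW_pos μ hG h1
  have : phi μ G K s * phi μ G K s = (1 / μ.E (ind (WW G s)) ^ 2) • fun x =>
      ind (WW G s) x * (fun a => (ind (K s.1) a / μ.m s.1 (K s.1) - 1) *
        (ind (K s.1) a / μ.m s.1 (K s.1) - 1)) (x s.1) := by
    ext x
    simp only [phi, Pi.smul_apply, smul_eq_mul, Pi.mul_apply]
    have := ind_mul_self (WW G s) x
    linear_combination (1 / μ.E (ind (WW G s)) ^ 2 * ((ind (K s.1) (x s.1) / μ.m s.1 (K s.1) - 1) *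
        (ind (K s.1) (x s.1) / μ.m s.1 (K s.1) - 1))) * this
  have key := μ.E_cyl (W := WW G s) h1.2.2.2
    (fun a => (ind (K s.1) a / μ.m s.1 (K s.1) - 1) * (ind (K s.1) a / μ.m s.1 (K s.1) - 1))
  rw [μ.sum_tt _ hm] at key
  rw [this, map_smul]
  refine (congrArg (fun r : ℝ => (1 / μ.E (ind (WW G s)) ^ 2) • r) key).trans ?_
  rw [qq]
  change 1 / μ.E (ind (WW G s)) ^ 2 * (μ.E (ind (WW G s)) * _) = _
  field_simp

lemma E_phi_orth (hG : IsKellerFamily P G) {s t : Pr X} (hs : s ∈ SK hsys G K) (ht : t ∈ SK hsys G K) (hst : s ≠ t) :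
    μ.E (phi μ G K s * phi μ G K t) = 0 := by
  obtain ⟨h1, h2⟩ := (mem_SK hsys).1 hs
  obtain ⟨h3, h4⟩ := (mem_SK hsys).1 ht
  have hne : s.1 ≠ t.1 := by
    intro h
    apply hst
    obtain ⟨i, π⟩ := s
    obtain ⟨k, ρ⟩ := t
    simp only at h
    subst h
    exact congrArg (Sigma.mk i) (part_unique hsys h1.1 h3.1 h2 h4 (ne_univ hsys h1.1 h1.2.1 h2))
  have : phi μ G K s * phi μ G K t = (1 / μ.E (ind (WW G s)) * (1 / μ.E (ind (WW G t)))) • fun x =>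
      (ind (WW G s) x * (fun a => (ind (K s.1) a / μ.m s.1 (K s.1) - 1)) (x s.1)) *
      (ind (WW G t) x * (fun a => (ind (K t.1) a / μ.m t.1 (K t.1) - 1)) (x t.1)) := by
    ext x
    simp only [phi, Pi.smul_apply, smul_eq_mul, Pi.mul_apply]
    ring
  rw [this, map_smul]
  have := μ.E_orth hsys hG hne h1 h3 (fun a => (ind (K s.1) a / μ.m s.1 (K s.1) - 1))
    (fun a => (ind (K t.1) a / μ.m t.1 (K t.1) - 1)) (μ.sum_t _ (μ.m_pos s.1 h1.1 h2))
    (μ.sum_t _ (μ.m_pos t.1 h3.1 h4))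
  change _ • μ.E (fun x => (ind (polyUnion (restrictFam G s.1 s.2)) x * _) *
      (ind (polyUnion (restrictFam G t.1 t.2)) x * _)) = 0
  rw [this, smul_zero]

lemma E_box_phi (hK : K ∈ G) {s : Pr X} (hs : s ∈ SK hsys G K) :
    μ.E (ind (boxSet K) * phi μ G K s) = μ.E (ind (boxSet K)) * qq μ G K s := by
  have : ind (boxSet K) * phi μ G K s = qq μ G K s • ind (boxSet K) := by
    ext x
    simp only [phi, Pi.smul_apply, smul_eq_mul, Pi.mul_apply, qq]
    by_cases hx : x ∈ boxSet K
    · rw [ind_pos hx, ind_pos (box_sub_WW hsys hK hs hx), ind_pos (mem_boxSet.1 hx s.1)]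
      ring
    · rw [ind_neg hx]; ring
  rw [this, map_smul, smul_eq_mul, mul_comm]

lemma E_U_phi {s : Pr X} (hs : s ∈ SK hsys G K) :
    μ.E (ind (polyUnion G) * phi μ G K s) = 0 := by
  have : ind (polyUnion G) * phi μ G K s = phi μ G K s := by
    ext x
    simp only [phi, Pi.mul_apply]
    rw [← mul_assoc, ← mul_div_assoc, ind_mul_sub (WW_sub G s)]
  rw [this, E_phi hsys μ hs]

/-- The defect function. -/
noncomputable def defect (hsys : IsBoxSystem X P) (μ : Wt X P) (G : Set (∀ i, Set (X i)))
    (K : ∀ i, Set (X i)) : (∀ i, X i) → ℝ :=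
  (1 / μ.E (ind (boxSet K))) • ind (boxSet K) - (1 / μ.E (ind (polyUnion G))) • ind (polyUnion G)
    - ∑ s ∈ SK hsys G K, phi μ G K s

lemma E_defect (hG : IsKellerFamily P G) (hK : K ∈ G) : μ.E (defect hsys μ G K * defect hsys μ G K) =
    1 / μ.E (ind (boxSet K)) - 1 / μ.E (ind (polyUnion G)) - ∑ s ∈ SK hsys G K, qq μ G K s := by
  classical
  have hk := μ.box_pos (hG.2.1 K hK)
  have hu := μ.poly_pos hG
  set a := ind (boxSet K) with ha
  set b := ind (polyUnion G) with hb
  set c := ∑ s ∈ SK hsys G K, phi μ G K s with hc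
  have haa : a * a = a := by ext x; exact ind_mul_self _ _
  have hbb : b * b = b := by ext x; exact ind_mul_self _ _
  have hba : b * a = a := by ext x; exact ind_mul_sub (box_sub hK) _
  have hac : μ.E (a * c) = μ.E a * ∑ s ∈ SK hsys G K, qq μ G K s := by
    rw [hc, Finset.mul_sum, map_sum, Finset.mul_sum]
    exact Finset.sum_congr rfl fun s hs => E_box_phi hsys μ hK hs
  have hbc : μ.E (b * c) = 0 := by
    rw [hc, Finset.mul_sum, map_sum]
    exact Finset.sum_eq_zero fun s hs => E_U_phi hsys μ hs
  have hcc : μ.E (c * c) = ∑ s ∈ SK hsys G K, qq μ G K s := by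
    rw [hc, Finset.sum_mul, map_sum]
    refine Finset.sum_congr rfl fun s hs => ?_
    rw [Finset.mul_sum, map_sum, Finset.sum_eq_single s]
    · exact E_phi_phi hsys μ hG hs
    · intro t ht hts
      exact E_phi_orth hsys μ hG hs ht hts.symm
    · intro h; exact (h hs).elim
  have hexp : defect hsys μ G K * defect hsys μ G K =
      (1 / μ.E a) ^ 2 • (a * a) + (1 / μ.E b) ^ 2 • (b * b) + c * c
        - (2 * (1 / μ.E a) * (1 / μ.E b)) • (b * a) - (2 * (1 / μ.E a)) • (a * c)
        + (2 * (1 / μ.E b)) • (b * c) := by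
    ext x
    simp only [defect, ← ha, ← hb, ← hc, Pi.mul_apply, Pi.sub_apply, Pi.add_apply, Pi.smul_apply,
      smul_eq_mul]
    ring
  rw [hexp]
  simp only [map_add, map_sub, map_smul, smul_eq_mul, haa, hbb, hba, hac, hbc, hcc]
  field_simp
  ring

end bessel

lemma sum_ind (hsys : IsBoxSystem X P) {G : Set (∀ i, Set (X i))} (hG : IsKellerFamily P G)
    {S : Finset (∀ i, Set (X i))} (hS : ∀ K ∈ S, K ∈ G) (x : ∀ i, X i) :
    ∑ K ∈ S, ind (boxSet K) x = ind {y | ∃ K ∈ S, y ∈ boxSet K} x := by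
  by_cases h : ∃ K ∈ S, x ∈ boxSet K
  · rw [ind_pos (A := {y | ∃ K ∈ S, y ∈ boxSet K}) h]
    obtain ⟨K, hK, hx⟩ := h
    rw [Finset.sum_eq_single K, ind_pos hx]
    · intro L hL hLK
      apply ind_neg
      intro hxL
      exact hLK (box_unique hsys hG (hS L hL) (hS K hK) hxL hx)
    · intro h; exact (h hK).elim
  · rw [ind_neg (A := {y | ∃ K ∈ S, y ∈ boxSet K}) h]
    apply Finset.sum_eq_zero
    intro K hK
    exact ind_neg fun hx => h ⟨K, hK, hx⟩

lemma sum_E_box (hsys : IsBoxSystem X P) (μ : Wt X P) {G : Set (∀ i, Set (X i))}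
    (hG : IsKellerFamily P G)
    {S : Finset (∀ i, Set (X i))} (hS : ∀ K ∈ S, K ∈ G) :
    ∑ K ∈ S, μ.E (ind (boxSet K)) = μ.E (ind {y | ∃ K ∈ S, y ∈ boxSet K}) := by
  rw [← map_sum]
  congr 1
  ext x
  rw [Finset.sum_apply, sum_ind hsys hG hS]

open Classical in
lemma sum_hidden (hsys : IsBoxSystem X P) (μ : Wt X P) {G : Set (∀ i, Set (X i))}
    (hG : IsKellerFamily P G) (hfin : G.Finite) {s : Pr X} (hs : HiddenIn P G s.1 s.2) :
    ∑ K ∈ hfin.toFinset.filter (fun K => K s.1 ∈ s.2), μ.E (ind (boxSet K)) * qq μ G K s =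
      s.2.ncard - 1 := by
  have hw := WW_pos μ hG hs
  have hπfin := hsys.2.2.1 s.1 s.2 hs.1
  have hset : {y | ∃ K ∈ hfin.toFinset.filter (fun K => K s.1 ∈ s.2), y ∈ boxSet K} = WW G s := by
    ext y
    simp [WW, mem_poly, restrictFam]
  have h1 : ∑ K ∈ hfin.toFinset.filter (fun K => K s.1 ∈ s.2), μ.E (ind (boxSet K)) =
      μ.E (ind (WW G s)) := by
    rw [sum_E_box hsys μ hG (by simp +contextual), hset]
  have h2 : ∑ K ∈ hfin.toFinset.filter (fun K => K s.1 ∈ s.2),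
      μ.E (ind (boxSet K)) * (1 / μ.m s.1 (K s.1)) = s.2.ncard * μ.E (ind (WW G s)) := by
    rw [← Finset.sum_fiberwise_of_maps_to (t := hπfin.toFinset) (g := fun K => K s.1)]
    · rw [Set.ncard_eq_toFinset_card _ hπfin, ← nsmul_eq_mul, ← Finset.sum_const]
      refine Finset.sum_congr rfl fun A hA => ?_
      have hA' : A ∈ s.2 := by simpa using hA
      have hm := μ.m_pos s.1 hs.1 hA'
      have e1 : ∑ K ∈ (hfin.toFinset.filter (fun K => K s.1 ∈ s.2)).filter (fun K => K s.1 = A),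
          μ.E (ind (boxSet K)) * (1 / μ.m s.1 (K s.1)) =
          (∑ K ∈ (hfin.toFinset.filter (fun K => K s.1 ∈ s.2)).filter (fun K => K s.1 = A),
          μ.E (ind (boxSet K))) * (1 / μ.m s.1 A) := by
        rw [Finset.sum_mul]
        refine Finset.sum_congr rfl fun K hK => ?_
        rw [(Finset.mem_filter.1 hK).2]
      rw [e1, sum_E_box hsys μ hG (by simp +contextual)]
      have e2 : ind {y | ∃ K ∈ (hfin.toFinset.filter (fun K => K s.1 ∈ s.2)).filter
          (fun K => K s.1 = A), y ∈ boxSet K} = fun x => ind (WW G s) x * ind A (x s.1) := by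
        ext x
        by_cases hx : x ∈ {y | ∃ K ∈ (hfin.toFinset.filter (fun K => K s.1 ∈ s.2)).filter
          (fun K => K s.1 = A), y ∈ boxSet K}
        · rw [ind_pos hx]
          obtain ⟨K, hK, hKx⟩ := hx
          simp only [Finset.mem_filter, Set.Finite.mem_toFinset] at hK
          have := mem_boxSet.1 hKx s.1
          rw [hK.2] at this
          rw [ind_pos this, ind_pos (show x ∈ WW G s from mem_poly.2 ⟨K, ⟨hK.1.1, hK.1.2⟩, hKx⟩)]
          norm_num
        · rw [ind_neg hx]
          by_cases hxA : x s.1 ∈ A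
          · rw [ind_neg (A := WW G s), zero_mul]
            intro hxW
            obtain ⟨K, hK, hKx⟩ := mem_poly.1 hxW
            apply hx
            refine ⟨K, ?_, hKx⟩
            simp only [Finset.mem_filter, Set.Finite.mem_toFinset]
            exact ⟨⟨hK.1, hK.2⟩, part_eq hsys hs.1 hK.2 hA' (mem_boxSet.1 hKx s.1) hxA⟩
          · rw [ind_neg hxA, mul_zero]
      rw [e2, μ.E_cyl (W := WW G s) hs.2.2.2]
      change μ.E (ind (WW G s)) * μ.m s.1 A * _ = _
      field_simp
    · intro K hK
      simp only [Finset.mem_filter] at hK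
      simpa using hK.2
  have h3 : ∑ K ∈ hfin.toFinset.filter (fun K => K s.1 ∈ s.2), μ.E (ind (boxSet K)) * qq μ G K s =
      (∑ K ∈ hfin.toFinset.filter (fun K => K s.1 ∈ s.2),
        μ.E (ind (boxSet K)) * (1 / μ.m s.1 (K s.1)) -
      ∑ K ∈ hfin.toFinset.filter (fun K => K s.1 ∈ s.2), μ.E (ind (boxSet K))) /
        μ.E (ind (WW G s)) := by
    rw [← Finset.sum_sub_distrib, Finset.sum_div]
    refine Finset.sum_congr rfl fun K _ => ?_
    unfold qq
    ring
  rw [h3, h1, h2]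
  field_simp

lemma sum_defect (hsys : IsBoxSystem X P) (μ : Wt X P) {G : Set (∀ i, Set (X i))}
    (hG : IsKellerFamily P G) (hfin : G.Finite) :
    ∑ K ∈ hfin.toFinset, μ.E (ind (boxSet K)) * μ.E (defect hsys μ G K * defect hsys μ G K) =
      (G.ncard : ℝ) - 1 - cTotal P G := by
  classical
  have hu := μ.poly_pos hG
  have h1 : ∀ K ∈ hfin.toFinset,
      μ.E (ind (boxSet K)) * μ.E (defect hsys μ G K * defect hsys μ G K) =
      1 - μ.E (ind (boxSet K)) / μ.E (ind (polyUnion G)) -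
        ∑ s ∈ SK hsys G K, μ.E (ind (boxSet K)) * qq μ G K s := by
    intro K hK
    have hK' : K ∈ G := by simpa using hK
    have hk := μ.box_pos (hG.2.1 K hK')
    rw [E_defect hsys μ hG hK', ← Finset.mul_sum]
    field_simp
  rw [Finset.sum_congr rfl h1, Finset.sum_sub_distrib, Finset.sum_sub_distrib, ← Finset.sum_div,
    sum_E_box hsys μ hG (by simp)]
  have h2 : {y | ∃ K ∈ hfin.toFinset, y ∈ boxSet K} = polyUnion G := by
    ext y; simp [mem_poly]
  rw [h2, div_self hu.ne']
  have h3 : ∑ K ∈ hfin.toFinset, ∑ s ∈ SK hsys G K, μ.E (ind (boxSet K)) * qq μ G K s =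
      ∑ s ∈ Hf hsys G, ∑ K ∈ hfin.toFinset.filter (fun K => K s.1 ∈ s.2),
        μ.E (ind (boxSet K)) * qq μ G K s := by
    simp only [SK, Finset.sum_filter]
    rw [Finset.sum_comm]
  rw [h3, Finset.sum_congr rfl fun s hs => sum_hidden hsys μ hG hfin ((mem_Hf hsys).1 hs),
    cTotal_eq hsys, Set.ncard_eq_toFinset_card _ hfin]
  push_cast
  simp only [Finset.sum_const, nsmul_eq_mul, mul_one]
  congr 1
  refine Finset.sum_congr rfl fun s hs => ?_
  have hh := (mem_Hf hsys).1 hs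
  have := nontriv_card hsys hh.1 hh.2.1
  rw [Nat.cast_sub (by omega)]
  simp

lemma sq_nonneg' (f : (∀ i, X i) → ℝ) (x : ∀ i, X i) : 0 ≤ (f * f) x := mul_self_nonneg _

lemma bound_of_wt (hsys : IsBoxSystem X P) (μ : Wt X P) {G : Set (∀ i, Set (X i))}
    (hG : IsKellerFamily P G) (hfin : G.Finite) : cTotal P G + 1 ≤ G.ncard := by
  have h := sum_defect hsys μ hG hfin
  have : 0 ≤ ∑ K ∈ hfin.toFinset,
      μ.E (ind (boxSet K)) * μ.E (defect hsys μ G K * defect hsys μ G K) :=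
    Finset.sum_nonneg fun K hK => mul_nonneg (μ.E_nonneg (ind_nonneg _))
      (μ.E_nonneg (sq_nonneg' _))
  rw [h] at this
  have h' : ((cTotal P G + 1 : ℕ) : ℝ) ≤ (G.ncard : ℝ) := by push_cast; linarith
  exact_mod_cast h'

lemma eqn (hsys : IsBoxSystem X P) (μ : Wt X P) {G : Set (∀ i, Set (X i))}
    (hG : IsKellerFamily P G) (hfin : G.Finite) (hc : cTotal P G + 1 = G.ncard)
    {K : ∀ i, Set (X i)} (hK : K ∈ G) {y : ∀ i, X i} (hy : ∀ i, y i ∈ μ.F i)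
    (hyG : y ∈ polyUnion G) (hyK : y ∉ boxSet K) :
    1 / μ.E (ind (polyUnion G)) + ∑ s ∈ SK hsys G K, phi μ G K s y = 0 := by
  have h := sum_defect hsys μ hG hfin
  have hc' : (G.ncard : ℝ) - 1 - cTotal P G = 0 := by
    rw [← hc]; push_cast; ring
  rw [hc', Finset.sum_eq_zero_iff_of_nonneg (fun K hK => mul_nonneg (μ.E_nonneg (ind_nonneg _))
      (μ.E_nonneg (sq_nonneg' _)))] at h
  have h1 := h K (by simpa using hK)
  have hk := μ.box_pos (hG.2.1 K hK)
  have h2 : μ.E (defect hsys μ G K * defect hsys μ G K) = 0 := by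
    rcases mul_eq_zero.1 h1 with h | h
    · exact (hk.ne' h).elim
    · exact h
  have h3 := μ.le_E (sq_nonneg' (defect hsys μ G K)) hy
  rw [h2] at h3
  have h4 : (defect hsys μ G K * defect hsys μ G K) y = 0 := by
    have := μ.prod_pos hy
    have h5 := sq_nonneg' (defect hsys μ G K) y
    by_contra h6
    have : 0 < (defect hsys μ G K * defect hsys μ G K) y := lt_of_le_of_ne h5 (Ne.symm h6)
    nlinarith
  have h5 : defect hsys μ G K y = 0 := by
    simpa using h4
  simp only [defect, Pi.sub_apply, Pi.smul_apply, smul_eq_mul, Finset.sum_apply, ind_pos hyG,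
    ind_neg hyK] at h5
  linarith

lemma exists_wt (hsys : IsBoxSystem X P) (x y : ∀ i, X i) : ∃ N : ℝ, 0 < N ∧
    ∀ ε : ℝ, 0 < ε → ε < 1 → ∃ μ : Wt X P, (∀ i, x i ∈ μ.F i) ∧ (∀ i, y i ∈ μ.F i) ∧
      (∀ i, 1 - ε ≤ μ.w i (x i)) ∧ ∀ i, ∀ a ∈ μ.F i, ε / N ≤ μ.w i a := by
  classical
  have hF : ∀ i, ∃ F : Finset (X i), x i ∈ F ∧ y i ∈ F ∧
      ∀ π ∈ P i, ∀ A ∈ π, ∃ a ∈ F, a ∈ A := by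
    intro i
    have hU : (⋃₀ (P i)).Finite := (hsys.2.1 i).sUnion fun π hπ => hsys.2.2.1 i π hπ
    have hne : ∀ A ∈ ⋃₀ (P i), A.Nonempty := by
      rintro A ⟨π, hπ, hA⟩
      exact (hsys.2.2.2.1 i π hπ).1 A hA
    let r : Set (X i) → X i := fun A => if h : A.Nonempty then h.some else x i
    refine ⟨insert (x i) (insert (y i) (hU.toFinset.image r)), by simp, by simp, ?_⟩
    intro π hπ A hA
    have hAU : A ∈ ⋃₀ (P i) := ⟨π, hπ, hA⟩
    refine ⟨r A, ?_, ?_⟩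
    · apply Finset.mem_insert_of_mem
      apply Finset.mem_insert_of_mem
      exact Finset.mem_image_of_mem _ (by rw [Set.Finite.mem_toFinset]; exact hAU)
    · simp only [r]
      rw [dif_pos (hne A hAU)]
      exact (hne A hAU).some_mem
  choose F hx hy hm using hF
  have hcpos : ∀ i, (0 : ℝ) < (F i).card := fun i => by
    exact_mod_cast Finset.card_pos.2 ⟨_, hx i⟩
  refine ⟨1 + ∑ i, ((F i).card : ℝ), by positivity, ?_⟩
  intro ε h0 h1
  refine ⟨⟨F, fun i a => ε / (F i).card + if a = x i then 1 - ε else 0, ?_, ?_, hm⟩,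
    hx, hy, ?_, ?_⟩
  · intro i a _
    have := div_pos h0 (hcpos i)
    split_ifs <;> linarith
  · intro i
    rw [Finset.sum_add_distrib, Finset.sum_const, nsmul_eq_mul, Finset.sum_ite_eq', if_pos (hx i)]
    have := hcpos i
    field_simp
    ring
  · intro i
    have := div_pos h0 (hcpos i)
    simp only [if_true]
    linarith
  · intro i a _
    have h2 : ε / (1 + ∑ i, ((F i).card : ℝ)) ≤ ε / (F i).card := by
      apply div_le_div_of_nonneg_left h0.le (hcpos i)
      have := Finset.single_le_sum (f := fun i => ((F i).card : ℝ)) (s := Finset.univ)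
        (fun _ _ => by positivity) (Finset.mem_univ i)
      linarith
    show _ ≤ ε / (F i).card + if a = x i then 1 - ε else 0
    split_ifs <;> linarith

lemma bound (hsys : IsBoxSystem X P) {G : Set (∀ i, Set (X i))}
    (hG : IsKellerFamily P G) (hfin : G.Finite) : cTotal P G + 1 ≤ G.ncard := by
  obtain ⟨K, hK⟩ := hG.1
  obtain ⟨x, -⟩ := box_nonempty hsys (hG.2.1 K hK)
  obtain ⟨N, hN, h⟩ := exists_wt hsys x x
  obtain ⟨μ, -⟩ := h (1 / 2) (by norm_num) (by norm_num)
  exact bound_of_wt hsys μ hG hfin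

/-- Two boxes are separated by a hidden partition. -/
lemma sep (hsys : IsBoxSystem X P) {G : Set (∀ i, Set (X i))}
    (hG : IsKellerFamily P G) (hfin : G.Finite) (hc : cTotal P G + 1 = G.ncard)
    {K : ∀ i, Set (X i)} (hK : K ∈ G) {y : ∀ i, X i}
    (hyG : y ∈ polyUnion G) (hyK : y ∉ boxSet K) :
    ∃ s : Pr X, HiddenIn P G s.1 s.2 ∧ K s.1 ∈ s.2 ∧ y ∈ WW G s ∧ y s.1 ∉ K s.1 := by
  obtain ⟨N, hN, h⟩ := exists_wt hsys y y
  obtain ⟨μ, hy, -⟩ := h (1 / 2) (by norm_num) (by norm_num)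
  have he := eqn hsys μ hG hfin hc hK hy hyG hyK
  have hu := μ.poly_pos hG
  have hu' : 0 < 1 / μ.E (ind (polyUnion G)) := by positivity
  by_contra hcon
  have : 0 ≤ ∑ s ∈ SK hsys G K, phi μ G K s y := by
    refine Finset.sum_nonneg fun s hs => ?_
    obtain ⟨h1, h2⟩ := (mem_SK hsys).1 hs
    have hw := WW_pos μ hG h1
    unfold phi
    by_cases hyW : y ∈ WW G s
    · have hyKs : y s.1 ∈ K s.1 := by
        by_contra h3
        exact hcon ⟨s, h1, h2, hyW, h3⟩
      rw [ind_pos hyW, ind_pos hyKs]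
      have hm := μ.m_pos s.1 h1.1 h2
      have hm1 := μ.m_le_one s.1 (K s.1)
      have : 1 ≤ 1 / μ.m s.1 (K s.1) := by
        rw [le_div_iff₀ hm]; linarith
      have h4 : 0 ≤ 1 / μ.m s.1 (K s.1) - 1 := by linarith
      positivity
    · rw [ind_neg hyW]; simp
  linarith

/-- The adjacency lemma. -/
lemma adj (hsys : IsBoxSystem X P) {G : Set (∀ i, Set (X i))}
    (hG : IsKellerFamily P G) (hfin : G.Finite) (hc : cTotal P G + 1 = G.ncard)
    {K : ∀ i, Set (X i)} (hK : K ∈ G) {p : ∀ i, X i} (hp : p ∈ boxSet K)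
    {i : Fin d} {π : Set (Set (X i))} (hπ : HiddenIn P G i π) (hKπ : K i ∈ π)
    {k : Fin d} {b : X k} (hmG : Function.update p k b ∈ polyUnion G)
    (hmπ : Function.update p k b ∉ WW G ⟨i, π⟩)
    {y : ∀ i, X i} (hyπ : y ∈ WW G ⟨i, π⟩) (hyi : y i ∉ K i) :
    ∃ ρ, HiddenIn P G k ρ ∧ K k ∈ ρ ∧ y ∈ WW G ⟨k, ρ⟩ ∧ y k ∈ K k := by
  classical
  by_contra hcon
  set z := Function.update p k b with hz
  obtain ⟨N, hN, h⟩ := exists_wt hsys z y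
  set C : ℝ := ((SK hsys G K).card : ℝ) with hC
  have hC0 : 0 ≤ C := by positivity
  have hd : (0 : ℝ) ≤ d := by positivity
  set D : ℝ := 2 + C * (4 * N) with hD
  have hD2 : 2 ≤ D := by have : 0 ≤ C * (4 * N) := by positivity
                         linarith
  set ε : ℝ := 1 / (2 * (d + 1) * D) with hε
  have hε0 : 0 < ε := by positivity
  have hεD : ε * (d + 1) * D = 1 / 2 := by rw [hε]; field_simp
  have hεd : ε * (d + 1) ≤ 1 / 4 := by
    have : 0 ≤ ε * (d + 1) := by positivity
    nlinarith
  have hε1 : ε ≤ 1 / 4 := by nlinarith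
  obtain ⟨μ, hzF, hyF, hwz, hwa⟩ := h ε hε0 (by linarith)
  have hyG : y ∈ polyUnion G := WW_sub _ _ hyπ
  have he := eqn hsys μ hG hfin hc hK hyF hyG (fun h => hyi (mem_boxSet.1 h i))
  -- Bernoulli
  have hbern : ∀ n : ℕ, n ≤ d → (1 / 2 : ℝ) ≤ (1 - ε) ^ n := by
    intro n hn
    have h1 := one_add_mul_le_pow (a := -ε) (by linarith) n
    have h2 : (n : ℝ) ≤ d := by exact_mod_cast hn
    rw [← sub_eq_add_neg] at h1
    nlinarith
  have hprodz : 1 - d * ε ≤ ∏ j, μ.w j (z j) := by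
    have h1 := one_add_mul_le_pow (a := -ε) (by linarith) d
    rw [← sub_eq_add_neg] at h1
    calc 1 - d * ε ≤ (1 - ε) ^ d := by linarith
      _ = ∏ _j : Fin d, (1 - ε) := by simp
      _ ≤ _ := Finset.prod_le_prod (fun _ _ => by linarith) fun j _ => hwz j
  have hu : 1 / 2 ≤ μ.E (ind (polyUnion G)) := by
    have h1 := μ.le_E (ind_nonneg (polyUnion G)) hzF
    rw [ind_pos hmG, mul_one] at h1
    nlinarith
  have hω : μ.E (ind (WW G ⟨i, π⟩)) ≤ d * ε := by
    have h1 := μ.le_E (f := fun x => 1 - ind (WW G ⟨i, π⟩) x)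
      (fun x => sub_nonneg.2 (ind_le_one _ _)) hzF
    have h2 : (fun x => 1 - ind (WW G ⟨i, π⟩) x) = (fun _ => 1) - ind (WW G ⟨i, π⟩) := rfl
    rw [ind_neg hmπ, h2, map_sub, μ.E_one] at h1
    linarith
  have hκ : ε / (2 * N) ≤ μ.E (ind (boxSet K)) := by
    obtain ⟨ρ, hρ, hKρ⟩ := hG.2.1 K hK k
    obtain ⟨r, hr, hrK⟩ := μ.meets k ρ hρ _ hKρ
    have hq : ∀ j, Function.update z k r j ∈ μ.F j := by
      intro j
      by_cases hj : j = k
      · subst hj; simpa using hr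
      · rw [Function.update_of_ne hj]; exact hzF j
    have hqK : Function.update z k r ∈ boxSet K := by
      rw [hz, Function.update_idem]
      apply update_box (b := p k) _ hrK
      simpa using hp
    have h1 := μ.le_E (ind_nonneg (boxSet K)) hq
    rw [ind_pos hqK, mul_one, ← Finset.mul_prod_erase _ _ (Finset.mem_univ k),
      Function.update_self] at h1
    have h2 : (1 / 2 : ℝ) ≤ ∏ j ∈ Finset.univ.erase k, μ.w j (Function.update z k r j) := by
      calc (1 / 2 : ℝ) ≤ (1 - ε) ^ (Finset.univ.erase k).card := hbern _ (by
              calc _ ≤ (Finset.univ : Finset (Fin d)).card := Finset.card_erase_le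
                _ = d := by simp)
        _ = ∏ j ∈ Finset.univ.erase k, (1 - ε) := by simp
        _ ≤ _ := Finset.prod_le_prod (fun _ _ => by linarith) fun j hj => by
            rw [Function.update_of_ne (Finset.ne_of_mem_erase hj)]; exact hwz j
    have h3 := hwa k r hr
    have h4 : 0 < ε / N := by positivity
    calc ε / (2 * N) = (ε / N) * (1 / 2) := by field_simp
      _ ≤ μ.w k r * ∏ j ∈ Finset.univ.erase k, μ.w j (Function.update z k r j) :=
          mul_le_mul h3 h2 (by norm_num) (by linarith)
      _ ≤ _ := h1
  have hκ0 : 0 < ε / (2 * N) := by positivity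
  have hω0 := WW_pos μ hG (s := ⟨i, π⟩) hπ
  have hmem : (⟨i, π⟩ : Pr X) ∈ SK hsys G K := (mem_SK hsys).2 ⟨hπ, hKπ⟩
  have hterm : ∀ s ∈ (SK hsys G K).erase ⟨i, π⟩, phi μ G K s y ≤ 4 * N := by
    intro s hs
    have hs' := Finset.mem_of_mem_erase hs
    obtain ⟨h1, h2⟩ := (mem_SK hsys).1 hs'
    have hw := WW_pos μ hG h1
    unfold phi
    by_cases hyW : y ∈ WW G s
    swap
    · rw [ind_neg hyW]; simp; positivity
    by_cases hyK : y s.1 ∈ K s.1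
    swap
    · rw [ind_neg hyK, ind_pos hyW]
      have : 0 < 1 / μ.E (ind (WW G s)) := by positivity
      simp only [zero_div]
      nlinarith
    rw [ind_pos hyW, ind_pos hyK]
    have hsk : s.1 ≠ k := by
      intro h
      apply hcon
      obtain ⟨j, ρ⟩ := s
      simp only at h
      subst h
      exact ⟨ρ, h1, h2, hyW, hyK⟩
    have hm : 1 - ε ≤ μ.m s.1 (K s.1) := by
      refine (hwz s.1).trans (μ.le_m s.1 (hzF s.1) ?_)
      rw [hz, Function.update_of_ne hsk]
      exact mem_boxSet.1 hp s.1
    have hm1 := μ.m_le_one s.1 (K s.1)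
    have hm0 : 0 < μ.m s.1 (K s.1) := by linarith
    have h3 : 1 / μ.m s.1 (K s.1) - 1 ≤ 2 * ε := by
      rw [sub_le_iff_le_add, div_le_iff₀ hm0]
      nlinarith
    have h4 : 1 / μ.E (ind (WW G s)) ≤ 1 / (ε / (2 * N)) := by
      apply one_div_le_one_div_of_le hκ0
      exact hκ.trans (μ.E_mono (ind_mono (box_sub_WW hsys hK hs')))
    have h5 : 0 < 1 / μ.E (ind (WW G s)) := by positivity
    calc 1 / μ.E (ind (WW G s)) * (1 / μ.m s.1 (K s.1) - 1)
        ≤ 1 / μ.E (ind (WW G s)) * (2 * ε) := mul_le_mul_of_nonneg_left h3 h5.le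
      _ ≤ 1 / (ε / (2 * N)) * (2 * ε) := mul_le_mul_of_nonneg_right h4 (by positivity)
      _ = 4 * N := by field_simp; norm_num
  rw [← Finset.add_sum_erase _ _ hmem] at he
  have hfirst : phi μ G K ⟨i, π⟩ y = - (1 / μ.E (ind (WW G ⟨i, π⟩))) := by
    unfold phi
    rw [ind_pos hyπ, ind_neg hyi]
    ring
  have hrest : ∑ s ∈ (SK hsys G K).erase ⟨i, π⟩, phi μ G K s y ≤ C * (4 * N) := by
    refine (Finset.sum_le_card_nsmul _ _ _ hterm).trans ?_
    rw [nsmul_eq_mul]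
    apply mul_le_mul_of_nonneg_right _ (by positivity)
    rw [hC]
    exact_mod_cast Finset.card_erase_le
  have hu2 : 1 / μ.E (ind (polyUnion G)) ≤ 2 := by
    rw [div_le_iff₀ (by linarith)]; linarith
  rw [hfirst] at he
  have h6 : 1 / μ.E (ind (WW G ⟨i, π⟩)) ≤ D := by linarith
  rw [div_le_iff₀ hω0] at h6
  have h7 : D * μ.E (ind (WW G ⟨i, π⟩)) ≤ D * (d * ε) :=
    mul_le_mul_of_nonneg_left hω (by linarith)
  nlinarith

/-- In the case of equality there is a laminating hidden partition. -/
lemma exists_pile (hsys : IsBoxSystem X P) {G : Set (∀ i, Set (X i))}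
    (hG : IsKellerFamily P G) (hfin : G.Finite) (hc : cTotal P G + 1 = G.ncard)
    (h2 : 2 ≤ G.ncard) : ∃ i, ∃ π, HiddenIn P G i π ∧ restrictFam G i π = G := by
  classical
  have hne : (Hf hsys G).Nonempty := by
    by_contra h
    rw [Finset.not_nonempty_iff_eq_empty] at h
    have := cTotal_eq hsys G
    rw [h, Finset.sum_empty] at this
    omega
  obtain ⟨s, hs, hmax⟩ := Finset.exists_max_image (Hf hsys G)
    (fun s => (restrictFam G s.1 s.2).ncard) hne
  obtain ⟨i, π⟩ := s
  have hπ : HiddenIn P G i π := (mem_Hf hsys).1 hs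
  refine ⟨i, π, hπ, ?_⟩
  by_contra hlam
  -- a box outside
  have hex : ∃ L ∈ G, L i ∉ π := by
    by_contra h
    push Not at h
    apply hlam
    ext K
    exact ⟨fun hK => hK.1, fun hK => ⟨hK, h K hK⟩⟩
  obtain ⟨L₀, hL₀, hL₀π⟩ := hex
  have hW : ∀ {K}, K ∈ G → ∀ {x}, x ∈ boxSet K → ∀ {s : Pr X}, x ∈ WW G s → K s.1 ∈ s.2 := by
    intro K hK x hx s hxs
    obtain ⟨M, hM, hMx⟩ := mem_poly.1 hxs
    rw [box_unique hsys hG hK hM.1 hx hMx]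
    exact hM.2
  have hn : ∃ n : ℕ, ∃ p m : ∀ i, X i, p ∈ WW G ⟨i, π⟩ ∧ m ∈ polyUnion G ∧ m ∉ WW G ⟨i, π⟩ ∧
      (Finset.univ.filter fun j => p j ≠ m j).card = n := by
    obtain ⟨m, hm⟩ := box_nonempty hsys (hG.2.1 L₀ hL₀)
    obtain ⟨K, hK⟩ := hπ.2.2.1.1
    obtain ⟨p, hp⟩ := box_nonempty hsys (hG.2.1 K hK.1)
    exact ⟨_, p, m, mem_poly.2 ⟨K, hK, hp⟩, mem_poly.2 ⟨L₀, hL₀, hm⟩,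
      fun h => hL₀π (hW hL₀ hm h), rfl⟩
  obtain ⟨p, m, hpW, hmG, hmW, hcard⟩ := Nat.find_spec hn
  obtain ⟨K, hK, hpK⟩ := mem_poly.1 hpW
  have hmK : m ∉ boxSet K := fun h => hmW (mem_poly.2 ⟨K, hK, h⟩)
  obtain ⟨⟨k, ρ⟩, hρ, hKρ, hmρ, hmk⟩ := sep hsys hG hfin hc hK.1 hmG hmK
  simp only at hρ hKρ hmk
  have hpρ : p ∈ WW G ⟨k, ρ⟩ := mem_poly.2 ⟨K, ⟨hK.1, hKρ⟩, hpK⟩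
  have hp'ρ : Function.update p k (m k) ∈ WW G ⟨k, ρ⟩ := hρ.2.2.2 p hpρ _
  have hp'W : Function.update p k (m k) ∉ WW G ⟨i, π⟩ := by
    intro h
    refine Nat.find_min hn ?_ ⟨_, m, h, hmG, hmW, rfl⟩
    rw [← hcard]
    apply Finset.card_lt_card
    refine ⟨fun j hj => ?_, fun hsub => ?_⟩
    · simp only [Finset.mem_filter, Finset.mem_univ, true_and] at hj ⊢
      by_cases hjk : j = k
      · subst hjk; simp at hj
      · rwa [Function.update_of_ne hjk] at hj
    · have hk : k ∈ Finset.univ.filter fun j => p j ≠ m j := by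
        simp only [Finset.mem_filter, Finset.mem_univ, true_and]
        intro h; exact hmk (h ▸ mem_boxSet.1 hpK k)
      have := hsub hk
      simp at this
  have hik : i ≠ k := by
    rintro rfl
    exact hp'W (hπ.2.2.2 p hpW _)
  have huniq : ∀ ρ', HiddenIn P G k ρ' → K k ∈ ρ' → ρ' = ρ := fun ρ' h h' =>
    part_unique hsys h.1 hρ.1 h' hKρ (ne_univ hsys hρ.1 hρ.2.1 hKρ)
  have step1 : ∀ y ∈ WW G ⟨i, π⟩, y i ∉ K i → y ∈ WW G ⟨k, ρ⟩ ∧ y k ∈ K k := by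
    intro y hy hyi
    obtain ⟨ρ', h1, h2, h3, h4⟩ := adj hsys hG hfin hc hK.1 hpK hπ hK.2 (WW_sub _ _ hp'ρ) hp'W hy hyi
    rw [huniq ρ' h1 h2] at h3
    exact ⟨h3, h4⟩
  have step2 : ∀ y ∈ WW G ⟨i, π⟩, y ∈ WW G ⟨k, ρ⟩ := by
    intro y hy
    by_cases hyi : y i ∈ K i
    swap
    · exact (step1 y hy hyi).1
    obtain ⟨a, ha⟩ := exists_other hsys hπ.1 hπ.2.1 hK.2
    have hy' : Function.update y i a ∈ WW G ⟨i, π⟩ := hπ.2.2.2 y hy a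
    obtain ⟨h1, h2⟩ := step1 _ hy' (by simpa using ha)
    obtain ⟨L, hL, hLy⟩ := mem_poly.1 hy'
    have hLρ : L k ∈ ρ := hW hL.1 hLy h1
    have hLK : L k = K k := part_eq hsys hρ.1 hLρ hKρ (mem_boxSet.1 hLy k) h2
    obtain ⟨b, hb⟩ := exists_other hsys hρ.1 hρ.2.1 hKρ
    have h3 : Function.update (Function.update y i a) k b ∈ WW G ⟨k, ρ⟩ := hρ.2.2.2 _ h1 b
    have h4 : Function.update (Function.update y i a) k b ∉ WW G ⟨i, π⟩ := by
      intro h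
      have := (step1 _ h (by rw [Function.update_of_ne hik]; simpa using ha)).2
      rw [Function.update_self] at this
      exact hb this
    have h5 : y i ∉ L i := by
      intro h
      have e := part_eq hsys hπ.1 hL.2 hK.2 h hyi
      have := mem_boxSet.1 hLy i
      rw [Function.update_self, e] at this
      exact ha this
    obtain ⟨ρ', e1, e2, e3, -⟩ := adj hsys hG hfin hc hL.1 hLy hπ hL.2 (WW_sub _ _ h3) h4 hy h5
    rw [hLK] at e2
    rw [huniq ρ' e1 e2] at e3
    exact e3
  have hss : restrictFam G i π ⊂ restrictFam G k ρ := by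
    refine ⟨fun M hM => ?_, fun hsub => ?_⟩
    · obtain ⟨x, hx⟩ := box_nonempty hsys (hG.2.1 M hM.1)
      exact ⟨hM.1, hW hM.1 hx (step2 x (mem_poly.2 ⟨M, hM, hx⟩))⟩
    · obtain ⟨M, hM, hMx⟩ := mem_poly.1 hp'ρ
      exact hp'W (mem_poly.2 ⟨M, hsub hM, hMx⟩)
  have hlt := Set.ncard_lt_ncard hss (hfin.subset fun M hM => hM.1)
  have hle := hmax ⟨k, ρ⟩ ((mem_Hf hsys).2 hρ)
  simp only at hle
  omega

end Analysis

theorem stmt_6 {d : ℕ} {X : Fin d → Type*} (P : ∀ i, Set (Set (Set (X i))))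
    (hsys : IsBoxSystem X P)
    (G : Set (∀ i, Set (X i))) (hG : IsKellerFamily P G) (hfin : G.Finite) :
    cTotal P G = G.ncard - 1 ↔ IsMultipile P G := by
  have hb := bound hsys hG hfin
  have hiff : cTotal P G = G.ncard - 1 ↔ cTotal P G + 1 = G.ncard := by omega
  rw [hiff]
  constructor
  · intro h
    exact multipile_of_eq hsys (fun G hG hf => bound hsys hG hf)
      (fun G hG hf hc h2 => exists_pile hsys hG hf hc h2) G.ncard G hG hfin rfl h
  · intro h
    exact multipile_eq hsys h hfin
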